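/- Let q be a prime power, n > 1 and 1 ≤ d < n integers, and let ℓ > 1 be an integer dividing q^n − 1 such that n ≥ 2d + 2·(|P_d| + 1)·(log ℓ / log q). Then there exists at least one α ∈ 𝔽_{q^n} of degree n over 𝔽_q such that ℓ divides the index [𝔽_{q^n}^× : H_α], where H_α is the subgroup of 𝔽_{q^n}^× generated by {g(α) : g ∈ P_d}; i.e., ℓ divides the number of connected components of the Cayley graph G_d(n,q,α). -/

import Mathlib

open Polynomial

/-- A polynomial is primary if it is a positive power of a monic irreducible polynomial. -/
def IsPrimaryPoly {F : Type*} [Field F] (g : Polynomial F) : Prop :=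
  ∃ p : Polynomial F, p.Monic ∧ Irreducible p ∧ ∃ e : ℕ, 0 < e ∧ g = p ^ e

/-- `primarySet F d` is the set `P_d` of monic primary polynomials of degree `d` over `F`. -/
def primarySet (F : Type*) [Field F] (d : ℕ) : Set (Polynomial F) :=
  {g | g.Monic ∧ g.natDegree = d ∧ IsPrimaryPoly g}

open Polynomial

section StepA

theorem aux_irreducible {L : Type*} [Field L] (w : L) (ℓ : ℕ) (hℓ : 0 < ℓ)
    (H : ∀ (r : ℕ) (v : L), v ^ ℓ = w ^ r → ℓ ∣ r) :
    Irreducible (X ^ ℓ - C w : L[X]) := by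
  have hmon : (X ^ ℓ - C w : L[X]).Monic := monic_X_pow_sub_C w hℓ.ne'
  have hdeg : (X ^ ℓ - C w : L[X]).natDegree = ℓ := natDegree_X_pow_sub_C
  have hne1 : (X ^ ℓ - C w : L[X]) ≠ 1 := by
    intro h
    rw [h] at hdeg
    simp at hdeg
    omega
  rw [hmon.irreducible_iff_natDegree]
  refine ⟨hne1, ?_⟩
  intro f g hf hg hfg
  have hsum : f.natDegree + g.natDegree = ℓ := by
    rw [← hf.natDegree_mul hg, hfg, hdeg]
  let Ω := AlgebraicClosure L
  have hsp : (f.map (algebraMap L Ω)).Splits := IsAlgClosed.splits _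
  have hroots : ∀ y ∈ (f.map (algebraMap L Ω)).roots, y ^ ℓ = algebraMap L Ω w := by
    intro y hy
    have h1 : eval y (f.map (algebraMap L Ω)) = 0 := (mem_roots'.1 hy).2
    have h2 : eval y ((f * g).map (algebraMap L Ω)) = 0 := by
      rw [Polynomial.map_mul, eval_mul, h1, zero_mul]
    rw [hfg] at h2
    simpa [sub_eq_zero] using h2
  have hc := hsp.coeff_zero_eq_prod_roots_of_monic (hf.map _)
  have hcard : (f.map (algebraMap L Ω)).roots.card = f.natDegree := by
    rw [← hsp.natDegree_eq_card_roots, natDegree_map]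
  have hpr : (f.map (algebraMap L Ω)).roots.prod ^ ℓ = (algebraMap L Ω w) ^ f.natDegree := by
    have h0 := Multiset.prod_map_pow (m := (f.map (algebraMap L Ω)).roots) (f := id) (n := ℓ)
    simp only [id, Multiset.map_id'] at h0
    rw [← h0, Multiset.map_congr rfl hroots, Multiset.map_const',
      Multiset.prod_replicate, hcard]
  have key : ((-1) ^ f.natDegree * f.coeff 0) ^ ℓ = w ^ f.natDegree := by
    apply (algebraMap L Ω).injective
    rw [map_pow, map_pow, ← hpr, map_mul]
    rw [coeff_map] at hc
    rw [hc, natDegree_map]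
    simp [← mul_assoc, ← pow_add, ← two_mul]
  have := H _ _ key
  rcases Nat.eq_zero_or_pos f.natDegree with h | h
  · exact Or.inl h
  · right
    have := Nat.le_of_dvd h this
    omega

theorem aux_natDegree_det {R : Type*} [CommRing R] {ι : Type*} [Fintype ι] [DecidableEq ι]
    (M : Matrix ι ι R[X]) (B : ℕ) (hM : ∀ i j, (M i j).natDegree ≤ B) :
    M.det.natDegree ≤ Fintype.card ι * B := by
  rw [Matrix.det_apply]
  apply natDegree_sum_le_of_forall_le
  intro σ _
  refine (natDegree_smul_le _ _).trans ?_
  refine (natDegree_prod_le _ _).trans ?_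
  refine (Finset.sum_le_sum (fun i _ => hM _ _)).trans ?_
  simp

theorem aux_indep {K : Type*} [Field K] (p : ℕ) [Fact p.Prime] [CharP K p] (μ : ℕ)
    (s ℓ B : ℕ) (hs : s = p ^ μ) (hℓ : 0 < ℓ) (hdvd : ℓ ∣ s - 1) (f : K[X])
    (H : ∀ (r : ℕ) (c : K) (S T : K[X]), c ≠ 0 → S ≠ 0 → C c * f ^ r * S ^ ℓ = T ^ ℓ → ℓ ∣ r)
    (hfB : f.natDegree ≤ B) (hB : 2 * ℓ * B < s) (g : Fin ℓ → K[X])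
    (hg : ∀ b, (g b).natDegree ≤ B) (hg0 : g ≠ 0) (e : K) (he : f.eval e ≠ 0) :
    ¬ (X - C e) ^ s ∣ ∑ b : Fin ℓ, g b * (f ^ ((s - 1) / ℓ)) ^ (b : ℕ) := by
  intro hdiv
  have hs0 : 0 < s := by omega
  have hf0 : f ≠ 0 := by rintro rfl; simp at he
  set v := f ^ ((s - 1) / ℓ) with hv
  have hvf : f * v ^ ℓ = f ^ s := by
    rw [hv, ← pow_mul, Nat.div_mul_cancel hdvd, ← pow_succ']
    congr 1; omega
  set θ : K[X][X] := ∑ b : Fin ℓ, C (g b) * X ^ (b : ℕ) with hθ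
  set G : K[X][X] := C f * X ^ ℓ - C (C (f.eval e ^ s)) with hG
  have hcoθ : ∀ i, θ.coeff i = if h : i < ℓ then g ⟨i, h⟩ else 0 := by
    intro i
    rw [hθ, finsetSum_coeff]
    simp only [coeff_C_mul, coeff_X_pow, mul_ite, mul_one, mul_zero]
    split_ifs with h
    · rw [Finset.sum_eq_single ⟨i, h⟩]
      · simp
      · intro b _ hb
        rw [if_neg]
        intro hi; apply hb; ext; simp [hi]
      · simp
    · apply Finset.sum_eq_zero
      intro b _
      rw [if_neg]; have := b.2; omega
  have hθ0 : θ ≠ 0 := by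
    intro h
    apply hg0
    ext1 b
    have := hcoθ b
    rw [h] at this
    simpa using this.symm
  have hθdeg : θ.natDegree < ℓ := by
    rw [natDegree_lt_iff_degree_lt hθ0, degree_lt_iff_coeff_zero]
    intro i hi
    rw [hcoθ, dif_neg (by omega)]
  have hGdeg : G.natDegree = ℓ := by
    rw [hG, natDegree_sub_C, natDegree_C_mul_X_pow _ _ hf0]
  have hcoG : ∀ i, (G.coeff i).natDegree ≤ B := by
    intro i
    rw [hG, coeff_sub, coeff_C_mul, coeff_X_pow, coeff_C]
    refine (natDegree_sub_le _ _).trans (max_le ?_ ?_)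
    · split_ifs <;> simp [hfB]
    · split_ifs
      · rw [natDegree_C]; exact Nat.zero_le _
      · simp
  have hcoθB : ∀ i, (θ.coeff i).natDegree ≤ B := by
    intro i
    rw [hcoθ]
    split_ifs
    · exact hg _
    · simp
  have hres : (resultant θ G).natDegree < s := by
    unfold resultant
    refine lt_of_le_of_lt (aux_natDegree_det _ B ?_) ?_
    · intro i j
      unfold sylvester
      rw [Matrix.of_apply]
      induction j using Fin.addCases with
      | left j => 
        rw [Fin.addCases_left]; split_ifs
        · exact hcoG _
        · simp
      | right j => 
        rw [Fin.addCases_right]; split_ifs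
        · exact hcoθB _
        · simp
    · rw [Fintype.card_fin, hGdeg]
      calc _ ≤ 2 * ℓ * B := by gcongr; omega
        _ < s := hB
  have hresdvd : (X - C e) ^ s ∣ resultant θ G := by
    obtain ⟨P, Q, -, -, h⟩ := exists_mul_add_mul_eq_C_resultant θ G le_rfl le_rfl
      (Or.inr (by omega))
    have h2 := congrArg (eval v) h
    rw [eval_C, eval_add, eval_mul, eval_mul] at h2
    rw [← h2]
    apply dvd_add
    · apply Dvd.dvd.mul_right
      simpa [hθ, eval_finsetSum] using hdiv
    · apply Dvd.dvd.mul_right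
      have : eval v G = (f - C (f.eval e)) ^ s := by
        rw [hs, sub_pow_char_pow, ← hs]
        simp [hG, hvf]
      rw [this]
      exact pow_dvd_pow_of_dvd (X_sub_C_dvd_sub_C_eval) _
  have hres0 : resultant θ G = 0 := by
    by_contra hne
    have := natDegree_le_of_dvd hresdvd hne
    rw [natDegree_pow, natDegree_X_sub_C] at this
    omega
  let L := FractionRing K[X]
  let φ := algebraMap K[X] L
  have hφ : Function.Injective φ := IsFractionRing.injective K[X] L
  have hmap : resultant (θ.map φ) (G.map φ) = 0 := by
    rw [natDegree_map_eq_of_injective hφ, natDegree_map_eq_of_injective hφ, resultant_map_map,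
      hres0, map_zero]
  rw [resultant_eq_zero_iff] at hmap
  apply hmap.2
  have hφf : φ f ≠ 0 := (map_ne_zero_iff φ hφ).2 hf0
  have hGmap : G.map φ = C (φ f) * (X ^ ℓ - C (φ (C (f.eval e ^ s)) / φ f)) := by
    rw [hG, mul_sub, ← C_mul, mul_div_cancel₀ _ hφf]
    simp
  have hirr : Irreducible (X ^ ℓ - C (φ (C (f.eval e ^ s)) / φ f)) := by
    apply aux_irreducible _ _ hℓ
    intro r v hvr
    obtain ⟨S, T, hT, hST⟩ := IsFractionRing.div_surjective (A := K[X]) v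
    have hT0 : T ≠ 0 := nonZeroDivisors.ne_zero hT
    -- (S/T)^ℓ = (c/f)^r
    have hφT : φ T ≠ 0 := (map_ne_zero_iff φ hφ).2 hT0
    rw [← hST, div_pow, div_pow, div_eq_div_iff (pow_ne_zero _ hφT) (pow_ne_zero _ hφf)] at hvr
    have h3 : S ^ ℓ * f ^ r = C (f.eval e ^ s) ^ r * T ^ ℓ := by
      apply hφ
      simpa using hvr
    have hc : (f.eval e ^ s) ^ r ≠ 0 := pow_ne_zero _ (pow_ne_zero _ he)
    refine H r (((f.eval e ^ s) ^ r)⁻¹) S T (inv_ne_zero hc) ?_ ?_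
    · rintro rfl
      rw [zero_pow hℓ.ne', zero_mul] at h3
      have : (C (f.eval e ^ s) : K[X]) ≠ 0 := by
        simpa using (fun h => absurd h he)
      exact mul_ne_zero (pow_ne_zero _ this) (pow_ne_zero _ hT0) h3.symm
    · calc _ = C (((f.eval e ^ s) ^ r)⁻¹) * (S ^ ℓ * f ^ r) := by ring
        _ = C (((f.eval e ^ s) ^ r)⁻¹) * C ((f.eval e ^ s) ^ r) * T ^ ℓ := by
          rw [h3, ← C_pow]; ring
        _ = _ := by rw [← C_mul, inv_mul_cancel₀ hc]; simp
  rw [hGmap]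
  have hu : IsUnit (C (φ f) : L[X]) := isUnit_C.2 hφf.isUnit
  rw [isCoprime_mul_unit_left_right hu]
  rw [isCoprime_comm, hirr.coprime_iff_not_dvd]
  intro hd
  have hθm0 : θ.map φ ≠ 0 := (Polynomial.map_ne_zero_iff hφ).2 hθ0
  have := natDegree_le_of_dvd hd hθm0
  rw [natDegree_X_pow_sub_C, natDegree_map_eq_of_injective hφ] at this
  omega

end StepA

open Polynomial

section StepB

theorem aux_Psi_ne_zero {K : Type*} [Field K] [Fintype K] (p : ℕ) [Fact p.Prime] [CharP K p] (μ : ℕ)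
    (s ℓ B J : ℕ) (hs : s = p ^ μ) (hℓ : 0 < ℓ) (hdvd : ℓ ∣ s - 1) (f : K[X]) (hf0 : f ≠ 0)
    (H : ∀ (r : ℕ) (c : K) (S T : K[X]), c ≠ 0 → S ≠ 0 → C c * f ^ r * S ^ ℓ = T ^ ℓ → ℓ ∣ r)
    (hfB : f.natDegree ≤ B) (hB : 2 * ℓ * B < s) 
    (hcard : J * s + f.natDegree < Fintype.card K) (g : Fin ℓ → Fin J → K[X])
    (hg : ∀ b j, (g b j).natDegree ≤ B) (hg0 : g ≠ 0) :
    ∑ b : Fin ℓ, ∑ j : Fin J, g b j * X ^ ((j : ℕ) * s) * (f ^ ((s - 1) / ℓ)) ^ (b : ℕ) ≠ 0 := by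
  intro hzero
  have hs0 : 0 < s := by omega
  obtain ⟨b0, j0, i0, h0⟩ : ∃ b j i, (g b j).coeff i ≠ 0 := by
    by_contra! h
    apply hg0
    ext b j i
    simpa using h b j i
  set Z : K[X] := ∑ j : Fin J, C ((g b0 j).coeff i0) * X ^ ((j : ℕ) * s) with hZ
  have hZ0 : Z ≠ 0 := by
    intro h
    have h1 : Z.coeff ((j0 : ℕ) * s) = 0 := by rw [h]; simp
    rw [hZ, finsetSum_coeff, Finset.sum_eq_single j0] at h1
    · simp [h0] at h1
    · intro j _ hj
      rw [coeff_C_mul, coeff_X_pow, if_neg, mul_zero]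
      intro h2
      exact hj (Fin.ext (Nat.eq_of_mul_eq_mul_right hs0 h2).symm)
    · simp
  have hZdeg : Z.natDegree ≤ J * s := by
    apply natDegree_sum_le_of_forall_le
    intro j _
    refine (natDegree_C_mul_X_pow_le _ _).trans ?_
    gcongr
    exact j.2.le
  obtain ⟨e, he⟩ : ∃ e, (Z * f).eval e ≠ 0 := by
    by_contra! h
    have h1 : Z * f = 0 := by
      apply eq_zero_of_natDegree_lt_card_of_eval_eq_zero _ Function.injective_id
      · intro i; exact h i
      · refine lt_of_le_of_lt natDegree_mul_le ?_
        omega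
    exact mul_ne_zero hZ0 hf0 h1
  rw [eval_mul] at he
  have heZ := left_ne_zero_of_mul he
  have hef := right_ne_zero_of_mul he
  have hgd : ∀ b, (∑ j : Fin J, g b j * C (e ^ ((j : ℕ) * s))).natDegree ≤ B := by
    intro b
    apply natDegree_sum_le_of_forall_le
    intro j _
    exact (natDegree_mul_C_le _ _).trans (hg b j)
  refine aux_indep p μ s ℓ B hs hℓ hdvd f H hfB hB
    (fun b => ∑ j : Fin J, g b j * C (e ^ ((j : ℕ) * s))) hgd ?_ e hef ?_
  · intro h
    apply heZ
    have h1 := congrArg (fun P : K[X] => P.coeff i0) (congrFun h b0)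
    simp only [Pi.zero_apply, coeff_zero, finsetSum_coeff, coeff_mul_C] at h1
    rw [hZ, eval_finsetSum, ← h1]
    simp
  · rw [← dvd_neg, ← zero_sub, ← hzero, ← Finset.sum_sub_distrib]
    apply Finset.dvd_sum
    intro b _
    rw [Finset.sum_mul, ← Finset.sum_sub_distrib]
    apply Finset.dvd_sum
    intro j _
    rw [← sub_mul, ← mul_sub]
    apply Dvd.dvd.mul_right
    apply Dvd.dvd.mul_left
    have : (X - C e : K[X]) ^ s = X ^ s - C (e ^ s) := by
      rw [hs, sub_pow_char_pow, C_pow]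
    rw [this, mul_comm, pow_mul, pow_mul e, C_pow (a := e ^ s)]
    exact sub_dvd_pow_sub_pow _ _ _

theorem aux_stepanov {K : Type*} [Field K] [Fintype K] (p : ℕ) [Fact p.Prime] [CharP K p] (μ : ℕ)
    (s ℓ B J : ℕ) (hs : s = p ^ μ) (hℓ : 0 < ℓ) (hdvd : ℓ ∣ s - 1) (f : K[X]) (hf0 : f ≠ 0)
    (H : ∀ (r : ℕ) (c : K) (S T : K[X]), c ≠ 0 → S ≠ 0 → C c * f ^ r * S ^ ℓ = T ^ ℓ → ℓ ∣ r)
    (hK : Fintype.card K = s ^ 2)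
    (hfB : f.natDegree + 1 ≤ B) (hB : 2 * ℓ * B < s) 
    (hcard : J * s + f.natDegree < s ^ 2)
    (hcount : B * s + J + f.natDegree * s < ℓ * J * B) (A : Finset K)
    (hA : ∀ α ∈ A, f.eval α ^ ((s ^ 2 - 1) / ℓ) = 1) :
    A.card ≤ B + J * s + f.natDegree * s := by
  classical
  have hs0 : 0 < s := by omega
  set m := f.natDegree with hm
  set v := f ^ ((s - 1) / ℓ) with hv
  set gg : (Fin ℓ × Fin J × Fin B → K) → Fin ℓ → Fin J → K[X] :=
    fun c b j => ∑ i : Fin B, C (c (b, j, i)) * X ^ (i : ℕ) with hgg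
  set Θ : (Fin ℓ × Fin J × Fin B → K) → K[X] := fun c =>
    ∑ b : Fin ℓ, ∑ j : Fin J, (gg c b j) ^ s * X ^ (j : ℕ) * v ^ (ℓ - (b : ℕ)) with hΘ
  have hggdeg : ∀ c b j, (gg c b j).natDegree ≤ B - 1 := by
    intro c b j
    apply natDegree_sum_le_of_forall_le
    intro i _
    refine (natDegree_C_mul_X_pow_le _ _).trans ?_
    have := i.2; omega
  have hvdeg : ∀ k ≤ ℓ, (v ^ k).natDegree ≤ m * s := by
    intro k hk
    rw [hv, ← pow_mul]
    refine natDegree_pow_le.trans ?_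
    rw [mul_comm]
    gcongr
    calc (s - 1) / ℓ * k ≤ (s - 1) / ℓ * ℓ := by gcongr
      _ ≤ s - 1 := Nat.div_mul_le_self _ _
      _ ≤ s := by omega
  have hΘdeg : ∀ c, (Θ c).natDegree < B * s + J + m * s := by
    intro c
    have : (Θ c).natDegree ≤ (B - 1) * s + J + m * s := by
      apply natDegree_sum_le_of_forall_le
      intro b _
      apply natDegree_sum_le_of_forall_le
      intro j _
      refine natDegree_mul_le.trans ?_
      refine add_le_add (natDegree_mul_le.trans (add_le_add ?_ ?_)) (hvdeg _ (by omega))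
      · refine natDegree_pow_le.trans ?_
        rw [mul_comm]
        gcongr
        exact hggdeg _ _ _
      · refine (natDegree_X_pow_le _).trans j.2.le
    have h2 : (B - 1) * s < B * s := by
      apply Nat.mul_lt_mul_of_pos_right (by omega) hs0
    omega
  obtain ⟨c, c', hcc, heq⟩ := Fintype.exists_ne_map_eq_of_card_lt
    (fun (c : Fin ℓ × Fin J × Fin B → K) (t : Fin (B * s + J + m * s)) => (Θ c).coeff t) (by
      simp only [Fintype.card_fun, Fintype.card_fin, Fintype.card_prod]
      apply Nat.pow_lt_pow_right Fintype.one_lt_card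
      rw [← mul_assoc]; exact hcount)
  have hΘeq : Θ c = Θ c' := by
    ext t
    by_cases ht : t < B * s + J + m * s
    · exact congrFun heq ⟨t, ht⟩
    · rw [coeff_eq_zero_of_natDegree_lt ((hΘdeg c).trans_le (by omega)),
        coeff_eq_zero_of_natDegree_lt ((hΘdeg c').trans_le (by omega))]
  set g : Fin ℓ → Fin J → K[X] := fun b j => gg c b j - gg c' b j with hg
  have hggco : ∀ c b j (i : Fin B), (gg c b j).coeff i = c (b, j, i) := by
    intro c b j i
    rw [hgg, finsetSum_coeff, Finset.sum_eq_single i]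
    · simp
    · intro k _ hk
      rw [coeff_C_mul, coeff_X_pow, if_neg, mul_zero]
      intro h; exact hk (Fin.ext h.symm)
    · simp
  have hg0 : g ≠ 0 := by
    intro h
    apply hcc
    funext ⟨b, j, i⟩
    have h1 := congrFun (congrFun h b) j
    simp only [hg, Pi.zero_apply, sub_eq_zero] at h1
    rw [← hggco c, ← hggco c', h1]
  have hgdeg : ∀ b j, (g b j).natDegree ≤ B - 1 := by
    intro b j
    exact (natDegree_sub_le _ _).trans (max_le (hggdeg _ _ _) (hggdeg _ _ _))
  have hΘg : ∑ b : Fin ℓ, ∑ j : Fin J, (g b j) ^ s * X ^ (j : ℕ) * v ^ (ℓ - (b : ℕ)) = 0 := by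
    rw [← sub_eq_zero] at hΘeq
    rw [← hΘeq, hΘ]
    simp only [← Finset.sum_sub_distrib]
    refine Finset.sum_congr rfl fun b _ => Finset.sum_congr rfl fun j _ => ?_
    rw [hg, hs]
    simp only
    rw [sub_pow_char_pow]
    ring
  have hΨ := aux_Psi_ne_zero p μ s ℓ B J hs hℓ hdvd f hf0 H (by omega) hB (by rw [hK]; exact hcard) g
    (fun b j => (hgdeg b j).trans (by omega)) hg0
  set Ψ := ∑ b : Fin ℓ, ∑ j : Fin J, g b j * X ^ ((j : ℕ) * s) * (f ^ ((s - 1) / ℓ)) ^ (b : ℕ)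
    with hΨdef
  have hΨdeg : Ψ.natDegree ≤ B + J * s + m * s := by
    apply natDegree_sum_le_of_forall_le
    intro b _
    apply natDegree_sum_le_of_forall_le
    intro j _
    refine natDegree_mul_le.trans ?_
    refine add_le_add (natDegree_mul_le.trans (add_le_add ?_ ?_)) (hvdeg _ b.2.le)
    · have := hgdeg b j; omega
    · refine (natDegree_X_pow_le _).trans ?_
      gcongr
      exact j.2.le
  have hroot : ∀ α ∈ A, Ψ.eval α = 0 := by
    intro α hα
    have hfα := hA α hα
    set w := v.eval α with hw
    have hww : w * w ^ s = 1 := by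
      rw [← pow_succ', hw, hv, eval_pow, ← pow_mul, ← hfα]
      congr 1
      obtain ⟨k, hk⟩ := hdvd
      have h1 : s ^ 2 - 1 = ℓ * (k * (s + 1)) := by
        rw [← mul_assoc, ← hk]
        obtain ⟨t, rfl⟩ : ∃ t, s = t + 1 := ⟨s - 1, by omega⟩
        simp
        rw [Nat.sub_eq_iff_eq_add (Nat.one_le_pow _ _ (by omega))]
        ring
      rw [h1, hk, Nat.mul_div_cancel_left _ hℓ, Nat.mul_div_cancel_left _ hℓ]
    have hw0 : w ≠ 0 := by
      rintro h; rw [h, zero_mul] at hww; exact zero_ne_one hww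
    have hαs : α ^ (s ^ 2) = α := by rw [← hK]; exact FiniteField.pow_card α
    have h1 : (Ψ.eval α) ^ s * w ^ ℓ = 0 := by
      have h2 := congrArg (eval α) hΘg
      rw [eval_zero] at h2
      rw [← h2, hΨdef, eval_finsetSum, eval_finsetSum]
      rw [hs, sum_pow_char_pow, Finset.sum_mul]
      refine Finset.sum_congr rfl fun b _ => ?_
      rw [eval_finsetSum, eval_finsetSum, sum_pow_char_pow, Finset.sum_mul]
      refine Finset.sum_congr rfl fun j _ => ?_
      rw [← hs]
      simp only [eval_mul, eval_pow, eval_X]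
      rw [← eval_pow (n := (s - 1) / ℓ), ← hv, ← hw]
      have e1 : (α ^ ((j : ℕ) * s)) ^ s = α ^ (j : ℕ) := by
        rw [← pow_mul, mul_assoc, ← sq, mul_comm, pow_mul, hαs]
      have e2 : (w ^ (b : ℕ)) ^ s * w ^ ℓ = w ^ (ℓ - (b : ℕ)) := by
        have : w ^ ℓ = w ^ (b : ℕ) * w ^ (ℓ - (b : ℕ)) := by
          rw [← pow_add]; congr 1; have := b.2; omega
        rw [this]
        calc _ = (w * w ^ s) ^ (b : ℕ) * w ^ (ℓ - (b : ℕ)) := by ring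
          _ = _ := by rw [hww]; simp
      calc _ = (g b j).eval α ^ s * (α ^ ((j : ℕ) * s)) ^ s * ((w ^ (b : ℕ)) ^ s * w ^ ℓ) := by ring
        _ = _ := by rw [e1, e2]
    rcases mul_eq_zero.1 h1 with h | h
    · exact pow_eq_zero_iff hs0.ne' |>.1 h
    · exact absurd h (pow_ne_zero _ hw0)
  refine le_trans ?_ hΨdeg
  refine le_trans ?_ (card_roots' Ψ)
  refine le_trans (Finset.card_le_card (t := Ψ.roots.toFinset) ?_) (Multiset.toFinset_card_le _)
  intro α hα
  rw [Multiset.mem_toFinset, mem_roots hΨ]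
  exact hroot α hα

end StepB

open Polynomial

section StepC

theorem aux_twist_bound {K : Type*} [Field K] [Fintype K] (ℓ : ℕ) (hℓ : 0 < ℓ)
    (hdvd : ℓ ∣ Fintype.card K - 1)
    (ψ : MulChar K ℂ) (hψ : ψ ≠ 1) (hψℓ : ψ ^ ℓ = 1) (f : K[X]) (hf0 : f ≠ 0) (T : ℕ)
    (hT : ∀ (γ : K), γ ≠ 0 → ∀ A : Finset K,
      (∀ α ∈ A, (C γ * f).eval α ^ ((Fintype.card K - 1) / ℓ) = 1) → A.card ≤ T) :
    ‖∑ α : K, ψ (f.eval α)‖ ≤ ℓ * T - Fintype.card K + f.natDegree := by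
  classical
  set R := Fintype.card K with hR
  have hR1 : 1 < R := Fintype.one_lt_card
  have hcu : Fintype.card Kˣ = R - 1 := Fintype.card_units K
  set W : Subgroup Kˣ := (powMonoidHom ℓ : Kˣ →* Kˣ).range with hW
  have hWcard : Nat.card W * ℓ = R - 1 := by
    rw [hW, IsCyclic.card_powMonoidHom_range, Nat.card_eq_fintype_card, hcu,
      Nat.gcd_eq_right hdvd, Nat.div_mul_cancel hdvd]
  have hψW : ∀ w ∈ W, ψ ((w : Kˣ) : K) = 1 := by
    rintro w ⟨y, rfl⟩
    have : (ψ ^ ℓ) (y : K) = 1 := by rw [hψℓ]; exact MulChar.one_apply_coe y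
    simpa [MulChar.pow_apply_coe] using this
  set N : Kˣ → Finset K := fun γ => Finset.univ.filter
    (fun α => ∃ w ∈ W, (γ : K) * f.eval α = ((w : Kˣ) : K)) with hN
  have hNT : ∀ γ, (N γ).card ≤ T := by
    intro γ
    apply hT (γ : K) γ.ne_zero
    intro α hα
    obtain ⟨w, ⟨y, rfl⟩, hw⟩ := (Finset.mem_filter.1 hα).2
    rw [eval_mul, eval_C, hw]
    simp only [powMonoidHom_apply, Units.val_pow_eq_pow_val]
    rw [← pow_mul, Nat.mul_div_cancel' hdvd, ← Units.val_pow_eq_pow_val, ← hcu, pow_card_eq_one]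
    simp
  -- inner sum
  have hin : ∀ (φ : Kˣ → ℂ) (c : ℂ) (α : K) (u : Kˣ), (u : K) = f.eval α → 
      (∀ w ∈ W, φ (w * u⁻¹) = c) →
      ∑ γ : Kˣ, (if α ∈ N γ then φ γ else 0) = Nat.card W * c := by
    intro φ c α u hu hφ
    have h1 : ∀ γ : Kˣ, α ∈ N γ ↔ γ * u ∈ W := by
      intro γ
      simp only [hN, Finset.mem_filter, Finset.mem_univ, true_and, ← hu]
      constructor
      · rintro ⟨w, hw, h⟩
        have : γ * u = w := Units.ext (by simpa using h)
        rwa [this]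
      · intro h
        exact ⟨_, h, by simp⟩
    simp only [h1]
    rw [← Equiv.sum_comp (Equiv.mulRight u⁻¹)]
    simp only [Equiv.coe_mulRight, inv_mul_cancel_right]
    rw [← Finset.sum_filter, Finset.sum_congr rfl (g := fun _ => c)]
    · rw [Finset.sum_const, nsmul_eq_mul]
      congr 2
      rw [Nat.card_eq_fintype_card, Fintype.card_subtype]
    · intro w hw
      exact hφ w (Finset.mem_filter.1 hw).2
  have hzero : ∀ α, f.eval α = 0 → ∀ γ, α ∉ N γ := by
    intro α h γ hα
    obtain ⟨w, _, hw⟩ := (Finset.mem_filter.1 hα).2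
    rw [h, mul_zero] at hw
    exact w.ne_zero hw.symm
  have hS : ∑ γ : Kˣ, ψ⁻¹ (γ : K) * ((N γ).card : ℂ) = Nat.card W * ∑ α : K, ψ (f.eval α) := by
    have : ∀ γ : Kˣ, ψ⁻¹ (γ : K) * ((N γ).card : ℂ) =
        ∑ α : K, (if α ∈ N γ then ψ⁻¹ (γ : K) else 0) := by
      intro γ
      rw [← Finset.sum_filter, Finset.sum_const, nsmul_eq_mul, mul_comm]
      simp
    simp only [this]
    rw [Finset.sum_comm, Finset.mul_sum]
    refine Finset.sum_congr rfl fun α _ => ?_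
    by_cases h : f.eval α = 0
    · rw [h, MulChar.map_zero, mul_zero]
      exact Finset.sum_eq_zero fun γ _ => by rw [if_neg (hzero α h γ)]
    · refine hin (fun γ => ψ⁻¹ (γ : K)) _ α (Units.mk0 _ h) rfl ?_
      intro w hw
      rw [MulChar.inv_apply_eq_inv', Units.val_mul, map_mul, hψW w hw, one_mul]
      have h7 : ψ ((Units.mk0 _ h : Kˣ) : K) * ψ (((Units.mk0 _ h)⁻¹ : Kˣ) : K) = 1 := by
        rw [← map_mul, Units.mul_inv, map_one]
      exact (eq_inv_of_mul_eq_one_left h7).symm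
  have hcnt : ∑ γ : Kˣ, ((N γ).card : ℝ) =
      Nat.card W * ((Finset.univ.filter (fun α : K => f.eval α ≠ 0)).card : ℝ) := by
    have key : ∑ γ : Kˣ, ((N γ).card : ℂ) =
      Nat.card W * ((Finset.univ.filter (fun α : K => f.eval α ≠ 0)).card : ℂ) := by
      have : ∀ γ : Kˣ, ((N γ).card : ℂ) = ∑ α : K, (if α ∈ N γ then (1 : ℂ) else 0) := by
        intro γ
        simp
      simp only [this]
      rw [Finset.sum_comm, Finset.card_filter]
      push_cast
      rw [Finset.mul_sum]
      refine Finset.sum_congr rfl fun α _ => ?_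
      by_cases h : f.eval α = 0
      · rw [if_neg (by simpa using h), mul_zero]
        exact Finset.sum_eq_zero fun γ _ => by rw [if_neg (hzero α h γ)]
      · rw [if_pos h]
        exact hin (fun γ => 1) 1 α (Units.mk0 _ h) rfl (by simp)
    exact_mod_cast key
  have hψ0 : ∑ γ : Kˣ, ψ⁻¹ (γ : K) = 0 := by
    have h1 : ψ⁻¹ ≠ 1 := by simpa using hψ
    have h2 := MulChar.sum_eq_zero_of_ne_one h1
    rw [← h2]
    rw [Fintype.sum_eq_add_sum_subtype_ne _ (0 : K), MulChar.map_zero, zero_add]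
    exact Fintype.sum_equiv unitsEquivNeZero _ _ (fun x => rfl)
  have hnorm : ∀ γ : Kˣ, ‖ψ⁻¹ (γ : K)‖ = 1 := by
    intro γ
    have : (ψ ^ ℓ) (γ : K) = 1 := by rw [hψℓ]; exact MulChar.one_apply_coe γ
    rw [MulChar.pow_apply_coe] at this
    rw [MulChar.inv_apply_eq_inv', norm_inv, Complex.norm_eq_one_of_pow_eq_one this hℓ.ne', inv_one]
  have hnz : (R : ℝ) - f.natDegree ≤
      ((Finset.univ.filter (fun α : K => f.eval α ≠ 0)).card : ℝ) := by
    have h1 := Finset.card_filter_add_card_filter_not (s := (Finset.univ : Finset K))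
      (fun α : K => f.eval α = 0)
    have h2 : (Finset.univ.filter (fun α : K => f.eval α = 0)).card ≤ f.natDegree := by
      refine le_trans ?_ (card_roots' f)
      refine le_trans (Finset.card_le_card (t := f.roots.toFinset) ?_)
        (Multiset.toFinset_card_le _)
      intro α hα
      rw [Multiset.mem_toFinset, mem_roots hf0]
      exact (Finset.mem_filter.1 hα).2
    rw [Finset.card_univ, ← hR] at h1
    have h3 : ((Finset.univ.filter (fun α : K => f.eval α = 0)).card : ℝ) +
        ((Finset.univ.filter (fun α : K => ¬ f.eval α = 0)).card : ℝ) = R := by exact_mod_cast h1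
    have h4 : ((Finset.univ.filter (fun α : K => f.eval α = 0)).card : ℝ) ≤ f.natDegree := by
      exact_mod_cast h2
    linarith
  have hmain : ‖(Nat.card W : ℂ) * ∑ α : K, ψ (f.eval α)‖ ≤
      (R - 1 : ℝ) * T - Nat.card W * ((R : ℝ) - f.natDegree) := by
    rw [← hS]
    have : ∑ γ : Kˣ, ψ⁻¹ (γ : K) * ((N γ).card : ℂ) =
        ∑ γ : Kˣ, ψ⁻¹ (γ : K) * (((N γ).card : ℂ) - T) := by
      simp only [mul_sub, Finset.sum_sub_distrib, ← Finset.sum_mul, hψ0]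
      simp
    rw [this]
    refine (norm_sum_le _ _).trans ?_
    have h2 : ∀ γ : Kˣ, ‖ψ⁻¹ (γ : K) * (((N γ).card : ℂ) - T)‖ = T - ((N γ).card : ℝ) := by
      intro γ
      rw [norm_mul, hnorm, one_mul]
      have : (((N γ).card : ℂ) - T) = (((N γ).card - T : ℝ) : ℂ) := by push_cast; rfl
      rw [this, Complex.norm_real, Real.norm_eq_abs, abs_sub_comm, abs_of_nonneg]
      have := hNT γ
      rw [sub_nonneg]; exact_mod_cast this
    simp only [h2, Finset.sum_sub_distrib, hcnt]
    rw [Finset.sum_const, Finset.card_univ, hcu, nsmul_eq_mul, Nat.cast_sub hR1.le, Nat.cast_one]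
    have := mul_le_mul_of_nonneg_left hnz (Nat.cast_nonneg (α := ℝ) (Nat.card W))
    linarith
  have hWpos : (0 : ℝ) < Nat.card W := by exact_mod_cast Nat.card_pos
  have hWc : (Nat.card W : ℝ) * ℓ = R - 1 := by
    have : ((Nat.card W * ℓ : ℕ) : ℝ) = ((R - 1 : ℕ) : ℝ) := by rw [hWcard]
    rw [Nat.cast_sub hR1.le] at this
    push_cast at this
    exact this
  rw [norm_mul, Complex.norm_natCast, ← hWc] at hmain
  have h5 : (Nat.card W : ℝ) * ‖∑ α : K, ψ (f.eval α)‖ ≤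
      Nat.card W * (ℓ * T - R + f.natDegree) := by linarith
  exact le_of_mul_le_mul_left h5 hWpos

theorem aux_charsum {K : Type*} [Field K] [Fintype K] (p : ℕ) [Fact p.Prime] [CharP K p] (μ : ℕ)
    (s ℓ : ℕ) (hs : s = p ^ μ) (hℓ : 1 < ℓ) (hdvd : ℓ ∣ s - 1) (f : K[X]) (hf0 : f ≠ 0)
    (H : ∀ (r : ℕ) (c : K) (S T : K[X]), c ≠ 0 → S ≠ 0 → C c * f ^ r * S ^ ℓ = T ^ ℓ → ℓ ∣ r)
    (hK : Fintype.card K = s ^ 2) (ψ : MulChar K ℂ) (hψ : ψ ≠ 1) (hψℓ : ψ ^ ℓ = 1)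
    (hlarge : 100 * ℓ * (f.natDegree + 1) ≤ s) :
    ‖∑ α : K, ψ (f.eval α)‖ ≤ (ℓ * (5 * f.natDegree + 9) + 1 + f.natDegree : ℕ) * s := by
  set m := f.natDegree with hm
  obtain ⟨k, hk⟩ := hdvd
  have hs100 : 100 ≤ s := by nlinarith
  set B := (s - 1) / (2 * ℓ) with hB
  have hB1 : 2 * ℓ * B ≤ s - 1 := Nat.mul_div_le _ _
  have hB2 : s - 1 < 2 * ℓ * (B + 1) := by
    rw [hB]
    exact Nat.lt_mul_div_succ _ (by omega)
  set J := k + (4 * m + 9) with hJ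
  have hks : s = ℓ * k + 1 := by omega
  have h2k : 2 * k ≤ s := by nlinarith
  have hlm : 100 * ℓ * (m + 1) = 100 * (ℓ * m) + 100 * ℓ := by ring
  have hmlm : m ≤ ℓ * m := Nat.le_mul_of_pos_left _ (by omega)
  have hBm : m + 1 ≤ B := by
    rw [hB, Nat.le_div_iff_mul_le (by omega)]
    have : (m + 1) * (2 * ℓ) = 2 * (ℓ * m) + 2 * ℓ := by ring
    omega
  have h4 : s ≤ 4 * (ℓ * B) := by
    have : 2 * ℓ * (B + 1) = 2 * (ℓ * B) + 2 * ℓ := by ring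
    omega
  have hcount : B * s + J + m * s < ℓ * J * B := by
    have e1 : ℓ * J * B = ℓ * k * B + (4 * m + 8) * (ℓ * B) + ℓ * B := by rw [hJ]; ring
    have e2 : ℓ * k * B = B * s - B := by rw [hks]; rw [Nat.mul_add, mul_one, Nat.add_sub_cancel]; ring
    have e3 : B ≤ B * s := Nat.le_mul_of_pos_right _ (by omega)
    have e4 : (m + 2) * s ≤ (4 * m + 8) * (ℓ * B) := by nlinarith
    have e5 : (m + 2) * s = m * s + 2 * s := by ring
    have e6 : B ≤ ℓ * B := Nat.le_mul_of_pos_left _ (by omega)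
    omega
  have hcardJ : J * s + m < s ^ 2 := by
    have : J + 1 ≤ s := by omega
    have h2 : (J + 1) * s ≤ s * s := Nat.mul_le_mul_right _ this
    have h3 : (J + 1) * s = J * s + s := by ring
    have h4 : s * s = s ^ 2 := by ring
    omega
  have hdvds : ℓ ∣ s - 1 := ⟨k, hk⟩
  have hsq : s ^ 2 - 1 = (s - 1) * (s + 1) := by
    obtain ⟨t, rfl⟩ : ∃ t, s = t + 1 := ⟨s - 1, by omega⟩
    rw [Nat.sub_eq_iff_eq_add (Nat.one_le_pow _ _ (by omega))]
    simp only [Nat.add_sub_cancel]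
    ring
  have hdvd2 : ℓ ∣ Fintype.card K - 1 := by
    rw [hK, hsq]; exact Dvd.dvd.mul_right hdvds _
  have := aux_twist_bound ℓ (by omega) hdvd2 ψ hψ hψℓ f hf0 (B + J * s + m * s) (by
    intro γ hγ A hA
    have hdeg : (C γ * f).natDegree = m := natDegree_C_mul hγ
    have := aux_stepanov p μ s ℓ B J hs (by omega) hdvds (C γ * f)
      (mul_ne_zero (by simpa using hγ) hf0) (by
        intro r c S T hc hS h
        refine H r (c * γ ^ r) S T (mul_ne_zero hc (pow_ne_zero _ hγ)) hS ?_
        rw [← h, C_mul, C_pow, mul_pow]; ring) hK (by rw [hdeg]; exact hBm) (by omega)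
        (by rw [hdeg]; exact hcardJ) (by rw [hdeg]; exact hcount) A (by rw [← hK]; exact hA)
    rwa [hdeg] at this)
  refine this.trans ?_
  rw [hK]
  have hfin : ℓ * (B + J * s + m * s) + m ≤ (ℓ * (5 * m + 9) + 1 + m) * s + s ^ 2 := by
    have e1 : ℓ * (B + J * s + m * s) + m = ℓ * B + (ℓ * k) * s + ℓ * (5 * m + 9) * s + m := by
      rw [hJ]; ring
    have e2 : (ℓ * k) * s + s = s ^ 2 := by rw [hks]; ring
    have e3 : (ℓ * (5 * m + 9) + 1 + m) * s = ℓ * (5 * m + 9) * s + s + m * s := by ring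
    have e4 : m ≤ m * s := Nat.le_mul_of_pos_right _ (by omega)
    have e5 : 2 * ℓ * B = 2 * (ℓ * B) := by ring
    omega
  have hfin' : ((ℓ * (B + J * s + m * s) + m : ℕ) : ℝ) ≤
    (((ℓ * (5 * m + 9) + 1 + m) * s + s ^ 2 : ℕ) : ℝ) := by exact_mod_cast hfin
  push_cast at hfin' ⊢
  linarith

end StepC

open Polynomial

section Analytic

theorem aux_recurrence {N : ℕ} (z : Fin N → ℂ) (C ρ : ℝ) (hρ : 0 < ρ) (i0 : ℕ)
    (h : ∀ i, i0 ≤ i → ‖∑ j, z j ^ i‖ ≤ C * ρ ^ i) (j0 : Fin N) : ‖z j0‖ ≤ ρ := by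
  by_contra! hlt
  have hex : ∀ j, ∃ u : Circle, z j = ‖z j‖ * (u : ℂ) := by
    intro j
    refine ⟨Circle.exp (z j).arg, ?_⟩
    rw [Circle.coe_exp, Complex.norm_mul_exp_arg_mul_I]
  choose u hu using hex
  have hcl := mapClusterPt_one_atTop_pow (G := Fin N → Circle) u
  have hfr : ∃ᶠ i : ℕ in Filter.atTop, ∀ j, (1 / 2 : ℝ) < ((u j ^ i : Circle) : ℂ).re := by
    have hopen : {v : Fin N → Circle | ∀ j, (1 / 2 : ℝ) < ((v j : Circle) : ℂ).re} ∈
        nhds (1 : Fin N → Circle) := by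
      apply IsOpen.mem_nhds
      · rw [Set.ofPred_forall]
        apply isOpen_iInter_of_finite
        intro j
        apply isOpen_lt continuous_const
        exact Complex.continuous_re.comp (continuous_subtype_val.comp (continuous_apply j))
      · intro j
        norm_num
    exact (mapClusterPt_iff_frequently.1 hcl) _ hopen
  have hev : ∀ᶠ i : ℕ in Filter.atTop, 2 * C < (‖z j0‖ / ρ) ^ i :=
    (tendsto_pow_atTop_atTop_of_one_lt ((one_lt_div hρ).2 hlt)).eventually_gt_atTop _
  obtain ⟨i, hi, hi2, hi3⟩ := (hfr.and_eventually (hev.and (Filter.eventually_ge_atTop i0))).exists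
  have h1 := h i hi3
  have h2 : (∑ j, z j ^ i).re ≤ C * ρ ^ i := (Complex.re_le_norm _).trans h1
  rw [Complex.re_sum] at h2
  have h3 : ∀ j, ‖z j‖ ^ i * (1 / 2) ≤ (z j ^ i).re := by
    intro j
    have : z j ^ i = ((‖z j‖ ^ i : ℝ) : ℂ) * ((u j ^ i : Circle) : ℂ) := by
      conv_lhs => rw [hu j]
      rw [mul_pow]; push_cast; rfl
    rw [this, Complex.re_ofReal_mul]
    exact mul_le_mul_of_nonneg_left (hi j).le (by positivity)
  have h4 : ‖z j0‖ ^ i * (1 / 2) ≤ ∑ j, (z j ^ i).re :=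
    (h3 j0).trans (Finset.single_le_sum (f := fun j => (z j ^ i).re)
      (fun j _ => le_trans (by positivity) (h3 j)) (Finset.mem_univ j0))
  rw [div_pow, lt_div_iff₀ (by positivity)] at hi2
  linarith

theorem aux_newton (N : ℕ) (A S : ℕ → ℂ) (hA0 : A 0 = 1) (hA : ∀ j, N < j → A j = 0)
    (hrec : ∀ m : ℕ, (m : ℂ) * A m = ∑ r ∈ Finset.Icc 1 m, S r * A (m - r)) :
    ∃ ω : Fin N → ℂ, ∀ r, 1 ≤ r → S r = - ∑ i, ω i ^ r := by
  classical
  set P : ℂ[X] := ∑ j ∈ Finset.range (N + 1), C (A j) * X ^ (N - j) with hP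
  have hcoeff : ∀ j, j ≤ N → P.coeff (N - j) = A j := by
    intro j hj
    rw [hP, finsetSum_coeff, Finset.sum_eq_single j]
    · simp
    · intro b hb hbj
      have := Finset.mem_range.1 hb
      rw [coeff_C_mul, coeff_X_pow, if_neg (by omega), mul_zero]
    · intro h; exact absurd (Finset.mem_range.2 (by omega)) h
  have hdeg : P.natDegree ≤ N := by
    apply natDegree_sum_le_of_forall_le
    intro j _
    exact (natDegree_C_mul_X_pow_le _ _).trans (by omega)
  have hcN : P.coeff N = 1 := by have := hcoeff 0 (by omega); rwa [Nat.sub_zero, hA0] at this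
  have hdegN : P.natDegree = N := le_antisymm hdeg (le_natDegree_of_ne_zero (by rw [hcN]; simp))
  have hmon : P.Monic := by rw [Monic, leadingCoeff, hdegN, hcN]
  have hsp : P.Splits := IsAlgClosed.splits P
  have hcard : P.roots.card = N := by rw [← hdegN]; exact (splits_iff_card_roots.1 hsp)
  obtain ⟨ω, hω⟩ : ∃ ω : Fin N → ℂ, P.roots = Finset.univ.val.map ω := by
    obtain ⟨l, hl⟩ := Quot.exists_rep P.roots
    have hl' : (l : Multiset ℂ) = P.roots := hl
    have hlen : l.length = N := by rw [← hcard, ← hl']; rfl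
    subst hlen
    refine ⟨l.get, ?_⟩
    rw [← hl']
    simp
  refine ⟨ω, ?_⟩
  set e : ℕ → ℂ := fun k => MvPolynomial.aeval ω (MvPolynomial.esymm (Fin N) ℂ k) with he
  have hAe : ∀ k, A k = (-1) ^ k * e k := by
    intro k
    have hek : e k = P.roots.esymm k := by
      rw [hω]; exact MvPolynomial.aeval_esymm_eq_multiset_esymm _ _ _ _
    by_cases hk : k ≤ N
    · rw [← hcoeff k hk, hek, coeff_eq_esymm_roots_of_card (by rw [hcard, hdegN]) (by omega),
        hdegN, hmon.leadingCoeff, one_mul, Nat.sub_sub_self hk]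
    · rw [hA k (by omega), hek, Multiset.esymm, Multiset.powersetCard_eq_empty k (by omega)]
      simp
  have hnew : ∀ m : ℕ, (m : ℂ) * A m =
      ∑ r ∈ Finset.Icc 1 m, (- ∑ i, ω i ^ r) * A (m - r) := by
    intro m
    have h1 := congrArg (MvPolynomial.aeval ω) (MvPolynomial.mul_esymm_eq_sum (Fin N) ℂ m)
    simp only [map_mul, map_natCast, map_pow, map_neg, map_one, map_sum] at h1
    have hps : ∀ r, MvPolynomial.aeval ω (MvPolynomial.psum (Fin N) ℂ r) = ∑ i, ω i ^ r := by
      intro r; simp [MvPolynomial.psum]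
    simp only [hps] at h1
    change (m : ℂ) * e m = _ at h1
    rw [hAe m]
    have h2 : (m : ℂ) * ((-1) ^ m * e m) = (-1) ^ m * (m * e m) := by ring
    rw [h2, h1, ← mul_assoc, ← pow_add, show m + (m + 1) = 2 * m + 1 by ring, pow_succ, pow_mul]
    simp only [even_two, Even.neg_pow, one_pow, one_mul, mul_neg, neg_mul, Finset.sum_neg_distrib]
    congr 1
    refine Finset.sum_bij' (fun a _ => a.2) (fun r _ => (m - r, r)) ?_ ?_ ?_ ?_ ?_
    · intro a ha
      simp only [Finset.mem_filter, Finset.HasAntidiagonal.mem_antidiagonal] at ha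
      rw [Finset.mem_Icc]; omega
    · intro r hr
      rw [Finset.mem_Icc] at hr
      simp only [Finset.mem_filter, Finset.HasAntidiagonal.mem_antidiagonal]
      omega
    · intro a ha
      simp only [Finset.mem_filter, Finset.HasAntidiagonal.mem_antidiagonal] at ha
      ext <;> simp; omega
    · intro r hr; rfl
    · intro a ha
      simp only [Finset.mem_filter, Finset.HasAntidiagonal.mem_antidiagonal] at ha
      have : m - a.2 = a.1 := by omega
      rw [this, hAe a.1]
      change _ * e a.1 * _ = _
      ring
  intro r
  induction r using Nat.strong_induction_on with
  | _ r ih =>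
    intro hr
    have h1 := (hrec r).symm.trans (hnew r)
    rw [← Finset.Ico_insert_right (by omega), Finset.sum_insert (by simp), Finset.sum_insert (by simp),
      Nat.sub_self, hA0, mul_one, mul_one] at h1
    have h2 : ∑ x ∈ Finset.Ico 1 r, S x * A (r - x) =
      ∑ x ∈ Finset.Ico 1 r, (- ∑ i, ω i ^ x) * A (r - x) := by
      refine Finset.sum_congr rfl fun x hx => ?_
      rw [Finset.mem_Ico] at hx
      rw [ih x hx.2 hx.1]
    rw [h2] at h1
    exact add_right_cancel h1
end Analytic

open Polynomial

section LFun

theorem aux_finite_monic (E : Type*) [Field E] [Finite E] (m : ℕ) :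
    {h : E[X] | h.Monic ∧ h.natDegree = m}.Finite := by
  apply Set.Finite.of_injOn (t := Set.univ) (f := fun h : E[X] => fun i : Fin (m + 1) => h.coeff i)
  · intro _ _; trivial
  · intro a ha b hb hab
    ext i
    by_cases hi : i < m + 1
    · exact congrFun hab ⟨i, hi⟩
    · rw [coeff_eq_zero_of_natDegree_lt (by rw [ha.2]; omega),
        coeff_eq_zero_of_natDegree_lt (by rw [hb.2]; omega)]
  · exact Set.finite_univ

/-- monic polynomials of degree `m` -/
noncomputable def monicDeg (E : Type*) [Field E] [Finite E] (m : ℕ) : Finset E[X] :=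
  (aux_finite_monic E m).toFinset

theorem mem_monicDeg {E : Type*} [Field E] [Finite E] {m : ℕ} {h : E[X]} :
    h ∈ monicDeg E m ↔ h.Monic ∧ h.natDegree = m := by
  simp [monicDeg]

open Classical in
/-- monic irreducible polynomials of degree dividing `r` -/
noncomputable def irrDvd (E : Type*) [Field E] [Finite E] (r : ℕ) : Finset E[X] :=
  r.divisors.biUnion fun e => (monicDeg E e).filter Irreducible

theorem mem_irrDvd {E : Type*} [Field E] [Finite E] {r : ℕ} (hr : 1 ≤ r) {h : E[X]} :
    h ∈ irrDvd E r ↔ h.Monic ∧ Irreducible h ∧ h.natDegree ∣ r := by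
  simp only [irrDvd, Finset.mem_biUnion, Finset.mem_filter, mem_monicDeg, Nat.mem_divisors]
  constructor
  · rintro ⟨e, ⟨he, _⟩, ⟨h1, h2⟩, h3⟩
    exact ⟨h1, h3, h2 ▸ he⟩
  · rintro ⟨h1, h2, h3⟩
    exact ⟨_, ⟨h3, by omega⟩, ⟨h1, rfl⟩, h2⟩

theorem aux_irr_pos {E : Type*} [Field E] {P : E[X]} (hP : Irreducible P) : 0 < P.natDegree :=
  hP.natDegree_pos

open Classical in
theorem aux_degree_count {E : Type*} [Field E] [Finite E] (m : ℕ) (h : E[X]) (hh : h.Monic)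
    (hm : h.natDegree = m) :
    m = ∑ r ∈ Finset.Icc 1 m, ∑ P ∈ irrDvd E r,
      if P ^ (r / P.natDegree) ∣ h then P.natDegree else 0 := by
  set s := UniqueFactorizationMonoid.normalizedFactors h with hs
  have hh0 : h ≠ 0 := hh.ne_zero
  have hmemf : ∀ P ∈ s, P.Monic ∧ Irreducible P := by
    intro P hP
    have hi := UniqueFactorizationMonoid.irreducible_of_normalized_factor P hP
    refine ⟨?_, hi⟩
    rw [← UniqueFactorizationMonoid.normalize_normalized_factor P hP]
    exact monic_normalize hi.ne_zero
  have hprod : s.prod = h := by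
    have h1 := UniqueFactorizationMonoid.prod_normalizedFactors hh0
    refine eq_of_monic_of_associated ?_ hh h1
    simpa using monic_multiset_prod_of_monic s (fun P => P) (fun P hP => (hmemf P hP).1)
  have hdeg : m = (s.map natDegree).sum := by
    rw [← hm]
    conv_lhs => rw [← hprod]
    rw [natDegree_multiset_prod_of_monic _ (fun P hP => (hmemf P hP).1)]
  have hpow : ∀ P ∈ s, ∀ j, P ^ j ∣ h ↔ j ≤ s.count P := by
    intro P hP j
    rw [pow_dvd_iff_le_emultiplicity,
      UniqueFactorizationMonoid.emultiplicity_eq_count_normalizedFactors (hmemf P hP).2 hh0,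
      (hmemf P hP).1.normalize_eq_self]
    exact Nat.cast_le
  have hmem : ∀ P, P.Monic → Irreducible P → P ∣ h → P ∈ s := by
    intro P h1 h2 h3
    rw [hs, UniqueFactorizationMonoid.mem_normalizedFactors_iff' hh0]
    exact ⟨h2, h1.normalize_eq_self, h3⟩
  have hle : ∀ P j, P ^ j ∣ h → j * P.natDegree ≤ m := by
    intro P j hd
    rw [← hm, ← natDegree_pow]
    exact natDegree_le_of_dvd hd hh0
  have hcnt : ∀ P ∈ s, s.count P = ((Finset.Icc 1 m).filter (fun j => P ^ j ∣ h)).card := by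
    intro P hP
    have : (Finset.Icc 1 m).filter (fun j => P ^ j ∣ h) = Finset.Icc 1 (s.count P) := by
      ext j
      rw [Finset.mem_filter, Finset.mem_Icc, Finset.mem_Icc, ← hpow P hP]
      constructor
      · rintro ⟨⟨a, b⟩, c⟩; exact ⟨a, c⟩
      · rintro ⟨a, c⟩
        have := hle P j c
        have := aux_irr_pos (hmemf P hP).2
        exact ⟨⟨a, by nlinarith⟩, c⟩
    rw [this]; simp
  conv_lhs => rw [hdeg, Finset.sum_multiset_map_count]
  have : ∀ P ∈ s.toFinset, s.count P • P.natDegree =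
      ∑ j ∈ (Finset.Icc 1 m).filter (fun j => P ^ j ∣ h), P.natDegree := by
    intro P hP
    rw [Finset.sum_const, hcnt P (Multiset.mem_toFinset.1 hP)]
  rw [Finset.sum_congr rfl this]
  simp only [← Finset.sum_filter]
  rw [Finset.sum_sigma', Finset.sum_sigma']
  refine Finset.sum_bij' (fun x _ => ⟨x.2 * x.1.natDegree, x.1⟩)
    (fun y _ => ⟨y.2, y.1 / y.2.natDegree⟩) ?_ ?_ ?_ ?_ ?_
  · rintro ⟨P, j⟩ hx
    simp only [Finset.mem_sigma, Multiset.mem_toFinset, Finset.mem_filter, Finset.mem_Icc] at hx ⊢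
    have hp := aux_irr_pos (hmemf P hx.1).2
    have hpos : 1 ≤ j * P.natDegree := Nat.mul_pos (by omega) hp
    rw [mem_irrDvd hpos, Nat.mul_div_cancel _ hp]
    exact ⟨⟨hpos, hle P j hx.2.2⟩, ⟨(hmemf P hx.1).1, (hmemf P hx.1).2, Dvd.intro_left _ rfl⟩, hx.2.2⟩
  · rintro ⟨r, P⟩ hx
    simp only [Finset.mem_sigma, Multiset.mem_toFinset, Finset.mem_filter, Finset.mem_Icc] at hx ⊢
    obtain ⟨⟨h1, h2⟩, h3, h4⟩ := hx
    rw [mem_irrDvd h1] at h3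
    have hp := aux_irr_pos h3.2.1
    have hpos : 1 ≤ r / P.natDegree := Nat.div_pos (Nat.le_of_dvd h1 h3.2.2) hp
    refine ⟨hmem P h3.1 h3.2.1 ((dvd_pow_self P (by omega)).trans h4), ⟨hpos, ?_⟩, h4⟩
    exact (Nat.div_le_self _ _).trans h2
  · rintro ⟨P, j⟩ hx
    simp only [Finset.mem_sigma, Multiset.mem_toFinset] at hx
    have hp := aux_irr_pos (hmemf P hx.1).2
    simp [Nat.mul_div_cancel _ hp]
  · rintro ⟨r, P⟩ hx
    simp only [Finset.mem_sigma, Finset.mem_filter, Finset.mem_Icc] at hx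
    obtain ⟨⟨h1, h2⟩, h3, h4⟩ := hx
    rw [mem_irrDvd h1] at h3
    simp [Nat.div_mul_cancel h3.2.2]
  · rintro ⟨P, j⟩ hx
    rfl

theorem aux_rec {E : Type*} [Field E] [Finite E] (Χ : E[X] → ℂ) (h1 : Χ 1 = 1)
    (hmul : ∀ g h : E[X], g.Monic → h.Monic → Χ (g * h) = Χ g * Χ h) (m : ℕ) :
    (m : ℂ) * ∑ h ∈ monicDeg E m, Χ h = ∑ r ∈ Finset.Icc 1 m,
      (∑ P ∈ irrDvd E r, (P.natDegree : ℂ) * Χ P ^ (r / P.natDegree)) *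
        ∑ h ∈ monicDeg E (m - r), Χ h := by
  classical
  have hpow : ∀ P : E[X], P.Monic → ∀ j, Χ (P ^ j) = Χ P ^ j := by
    intro P hP j
    induction j with
    | zero => simp [h1]
    | succ j ih => rw [pow_succ, hmul _ _ (hP.pow j) hP, ih, pow_succ]
  have key : ∀ h ∈ monicDeg E m, (m : ℂ) * Χ h = ∑ r ∈ Finset.Icc 1 m, ∑ P ∈ irrDvd E r,
      if P ^ (r / P.natDegree) ∣ h then (P.natDegree : ℂ) * Χ h else 0 := by
    intro h hh
    rw [mem_monicDeg] at hh
    conv_lhs => rw [aux_degree_count m h hh.1 hh.2]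
    push_cast
    simp only [Finset.sum_mul]
    refine Finset.sum_congr rfl fun r _ => Finset.sum_congr rfl fun P _ => ?_
    split_ifs <;> simp
  rw [Finset.mul_sum, Finset.sum_congr rfl key, Finset.sum_comm]
  refine Finset.sum_congr rfl fun r hr => ?_
  rw [Finset.mem_Icc] at hr
  rw [Finset.sum_comm, Finset.sum_mul]
  refine Finset.sum_congr rfl fun P hP => ?_
  rw [mem_irrDvd hr.1] at hP
  set j := r / P.natDegree with hj
  have hjr : j * P.natDegree = r := Nat.div_mul_cancel hP.2.2
  have hPj : (P ^ j).Monic := hP.1.pow j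
  have hPjd : (P ^ j).natDegree = r := by rw [natDegree_pow, hjr]
  rw [← Finset.sum_filter, mul_assoc, ← hpow P hP.1, ← Finset.mul_sum]
  congr 1
  rw [Finset.mul_sum]
  refine Eq.symm (Finset.sum_bij (fun g _ => P ^ j * g) ?_ ?_ ?_ ?_)
  · intro g hg
    rw [mem_monicDeg] at hg
    rw [Finset.mem_filter, mem_monicDeg, hPj.natDegree_mul hg.1, hPjd, hg.2]
    exact ⟨⟨hPj.mul hg.1, by omega⟩, dvd_mul_right _ _⟩
  · intro a _ b _ hab
    exact mul_left_cancel₀ hPj.ne_zero hab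
  · intro h hh
    rw [Finset.mem_filter, mem_monicDeg] at hh
    obtain ⟨⟨h2, h3⟩, g, rfl⟩ := hh
    have hg : g.Monic := hPj.of_mul_monic_left h2
    refine ⟨g, ?_, rfl⟩
    rw [hPj.natDegree_mul hg, hPjd] at h3
    rw [mem_monicDeg]
    exact ⟨hg, by omega⟩
  · intro g hg
    rw [mem_monicDeg] at hg
    rw [hmul _ _ hPj hg.1]

theorem aux_vanish {E : Type*} [Field E] [Finite E] (Χ : E[X] → ℂ)
    (G : E[X]) (hG : G.Monic) (h0 : E[X]) (hcop : IsCoprime G h0) (hne : Χ h0 ≠ 1)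
    (hmul : ∀ h : E[X], Χ (h0 * h) = Χ h0 * Χ h)
    (hmod : ∀ g h : E[X], G ∣ g - h → Χ g = Χ h) (j : ℕ) (hj : G.natDegree ≤ j) :
    ∑ h ∈ monicDeg E j, Χ h = 0 := by
  classical
  set φ : E[X] → E[X] := fun h => h + (h0 * h - h) %ₘ G with hφ
  have hdvd : ∀ h, G ∣ φ h - h0 * h := by
    intro h
    have := modByMonic_add_div (h0 * h - h) G
    refine ⟨- ((h0 * h - h) /ₘ G), ?_⟩
    rw [hφ]
    linear_combination this
  have hdeglt : ∀ u : E[X], ∀ h ∈ monicDeg E j, (u %ₘ G).degree < h.degree := by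
    intro u h hh
    rw [mem_monicDeg] at hh
    refine (degree_modByMonic_lt u hG).trans_le ?_
    rw [degree_eq_natDegree hG.ne_zero, degree_eq_natDegree hh.1.ne_zero, hh.2]
    exact_mod_cast hj
  have hmaps : ∀ h ∈ monicDeg E j, φ h ∈ monicDeg E j := by
    intro h hh
    have h2 := hdeglt (h0 * h - h) h hh
    rw [mem_monicDeg] at hh ⊢
    refine ⟨hh.1.add_of_left h2, ?_⟩
    rw [natDegree_add_eq_left_of_degree_lt h2, hh.2]
  have hinj : Set.InjOn φ (monicDeg E j) := by
    intro a ha b hb hab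
    have h3 : G ∣ h0 * (a - b) := by
      have := dvd_sub (hdvd b) (hdvd a)
      rw [hab] at this
      convert this using 1
      ring
    have h4 : G ∣ a - b := hcop.dvd_of_dvd_mul_left h3
    have h5 : (h0 * a - a) %ₘ G = (h0 * b - b) %ₘ G := by
      apply modByMonic_eq_of_dvd_sub hG
      have : h0 * a - a - (h0 * b - b) = (h0 - 1) * (a - b) := by ring
      rw [this]
      exact h4.mul_left _
    have : a + (h0 * a - a) %ₘ G = b + (h0 * b - b) %ₘ G := hab
    rw [h5] at this
    exact add_right_cancel this
  have himg : (monicDeg E j).image φ = monicDeg E j := by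
    apply Finset.eq_of_subset_of_card_le
    · intro x hx
      obtain ⟨h, hh, rfl⟩ := Finset.mem_image.1 hx
      exact hmaps h hh
    · rw [Finset.card_image_of_injOn hinj]
  have hsum : Χ h0 * ∑ h ∈ monicDeg E j, Χ h = ∑ h ∈ monicDeg E j, Χ h := by
    conv_rhs => rw [← himg]
    rw [Finset.sum_image hinj, Finset.mul_sum]
    refine Finset.sum_congr rfl fun h _ => ?_
    rw [hmod _ _ (hdvd h), hmul]
  have : (Χ h0 - 1) * ∑ h ∈ monicDeg E j, Χ h = 0 := by rw [sub_mul, hsum]; ring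
  exact (mul_eq_zero.1 this).resolve_left (sub_ne_zero.2 hne)

theorem aux_monicDeg_zero {E : Type*} [Field E] [Finite E] (Χ : E[X] → ℂ) (h1 : Χ 1 = 1) :
    ∑ h ∈ monicDeg E 0, Χ h = 1 := by
  have : monicDeg E 0 = {1} := by
    ext h
    rw [mem_monicDeg, Finset.mem_singleton]
    constructor
    · rintro ⟨a, b⟩; exact a.natDegree_eq_zero.1 b
    · rintro rfl; simp
  rw [this, Finset.sum_singleton, h1]

end LFun

open Polynomial

section Res

theorem aux_res_prod {E Ω : Type*} [Field E] [Field Ω] [Algebra E Ω] (f h : E[X])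
    (hf : f.Monic) (hs : (f.map (algebraMap E Ω)).Splits) :
    algebraMap E Ω (resultant f h) =
      ((f.aroots Ω).map (fun c => aeval c h)).prod := by
  rw [← resultant_map_map]
  have := resultant_eq_prod_eval (f.map (algebraMap E Ω)) (h.map (algebraMap E Ω)) h.natDegree
    natDegree_map_le hs
  rw [natDegree_map] at this
  rw [this, (hf.map _).leadingCoeff, one_pow, one_mul]
  simp only [aroots_def, eval_map_algebraMap]

theorem aux_res_mul {E : Type*} [Field E] (f : E[X]) (hf : f.Monic) (g h : E[X]) :
    resultant f (g * h) = resultant f g * resultant f h := by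
  apply (algebraMap E (AlgebraicClosure E)).injective
  rw [map_mul]
  simp only [aux_res_prod f _ hf (IsAlgClosed.splits _), map_mul, Multiset.prod_map_mul]

theorem aux_res_mod {E : Type*} [Field E] (f : E[X]) (hf : f.Monic) (G : E[X]) (N : ℕ)
    (hG : f ∣ G ^ N) (g h : E[X]) (hd : G ∣ g - h) :
    resultant f g = resultant f h := by
  apply (algebraMap E (AlgebraicClosure E)).injective
  simp only [aux_res_prod f _ hf (IsAlgClosed.splits _)]
  congr 1
  refine Multiset.map_congr rfl fun c hc => ?_
  have h1 : aeval c f = 0 := (mem_aroots.1 hc).2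
  have h2 : aeval c G = 0 := by
    obtain ⟨t, ht⟩ := hG
    have : (aeval c G) ^ N = 0 := by rw [← map_pow, ht, map_mul, h1, zero_mul]
    exact eq_zero_of_pow_eq_zero this
  obtain ⟨t, ht⟩ := hd
  have : aeval c g - aeval c h = 0 := by rw [← map_sub, ht, map_mul, h2, zero_mul]
  exact sub_eq_zero.1 this

theorem aux_norm_aeval {E K : Type*} [Field E] [Finite E] [Field K] [Finite K] [Algebra E K]
    (f : E[X]) (α : K) :
    Algebra.norm E (aeval α f) =
      resultant (minpoly E α) f ^ (Module.finrank E K / (minpoly E α).natDegree) := by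
  classical
  have hIntegral : IsIntegral E α := Algebra.IsIntegral.isIntegral α
  set L := IntermediateField.adjoin E {α} with hL
  set g : L := IntermediateField.AdjoinSimple.gen E α with hg
  have hmul : Module.finrank E L * Module.finrank L K = Module.finrank E K :=
    Module.finrank_mul_finrank E L K
  have hLd : Module.finrank E L = (minpoly E α).natDegree :=
    IntermediateField.adjoin.finrank hIntegral
  have hpos : 0 < (minpoly E α).natDegree := minpoly.natDegree_pos hIntegral
  have hdiv : Module.finrank E K / (minpoly E α).natDegree = Module.finrank L K := by
    rw [← hmul, hLd, Nat.mul_div_cancel_left _ hpos]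
  rw [hdiv]
  have h1 : aeval α f = algebraMap L K (aeval g f) := by
    rw [← aeval_algebraMap_apply]
    congr 1
  rw [h1, ← Algebra.norm_norm (S := L), Algebra.norm_algebraMap, map_pow]
  congr 1
  apply (algebraMap E (AlgebraicClosure E)).injective
  rw [aux_res_prod _ _ (minpoly.monic hIntegral) (IsAlgClosed.splits _),
    Algebra.norm_eq_prod_embeddings E (AlgebraicClosure E)]
  let pb := IntermediateField.adjoin.powerBasis hIntegral
  have hgen : pb.gen = g := IntermediateField.adjoin.powerBasis_gen hIntegral
  have hmin : minpoly E pb.gen = minpoly E α := by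
    rw [hgen]
    exact IntermediateField.minpoly_gen E α
  have e1 : ∀ σ : L →ₐ[E] AlgebraicClosure E, σ (aeval g f) = aeval (σ g) f := by
    intro σ; rw [aeval_algHom_apply]
  simp only [e1]
  rw [Fintype.prod_equiv pb.liftEquiv' (fun σ => aeval (σ g) f) (fun x => aeval (x : AlgebraicClosure E) f)
    (by intro σ; simp only [PowerBasis.liftEquiv'_apply_coe, hgen])]
  rw [Finset.prod_mem_multiset _ _ (fun x => aeval (x : AlgebraicClosure E) f)
    (by intro x; rfl), Finset.prod_eq_multiset_prod, Multiset.toFinset_val,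
      Multiset.dedup_eq_self.mpr, hmin]
  apply nodup_aroots_iff_of_splits _ _ |>.2
  · exact Algebra.IsSeparable.isSeparable E pb.gen
  · exact minpoly.ne_zero (pb.isIntegral_gen)
  · exact IsAlgClosed.splits _

theorem aux_Sr {E K : Type*} [Field E] [Finite E] [Field K] [Fintype K] [Algebra E K]
    (r : ℕ) (hr : Module.finrank E K = r) (f : E[X]) (χ : MulChar E ℂ) :
    ∑ α : K, χ (Algebra.norm E (aeval α f)) =
      ∑ P ∈ irrDvd E r, (P.natDegree : ℂ) * χ (resultant P f) ^ (r / P.natDegree) := by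
  classical
  have hr1 : 1 ≤ r := by rw [← hr]; exact Module.finrank_pos
  have hmaps : ∀ α ∈ (Finset.univ : Finset K), minpoly E α ∈ irrDvd E r := by
    intro α _
    have hIntegral : IsIntegral E α := Algebra.IsIntegral.isIntegral α
    rw [mem_irrDvd hr1]
    refine ⟨minpoly.monic hIntegral, minpoly.irreducible hIntegral, ?_⟩
    rw [← hr]
    exact minpoly.degree_dvd hIntegral
  rw [← Finset.sum_fiberwise_of_maps_to hmaps]
  refine Finset.sum_congr rfl fun P hP => ?_
  rw [mem_irrDvd hr1] at hP
  rw [Finset.sum_congr rfl (g := fun _ => χ (resultant P f) ^ (r / P.natDegree))]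
  · rw [Finset.sum_const, nsmul_eq_mul]
    congr 2
    have hcard : Nat.card K = Nat.card E ^ r := by
      rw [← hr]; exact Module.natCard_eq_pow_finrank
    have hdv : P ∣ X ^ Nat.card K - X := by
      rw [hcard]
      exact hP.2.1.natDegree_dvd_iff_dvd_X_pow_card_pow_sub_X.1 hP.2.2
    have hsp : (P.map (algebraMap E K)).Splits := by
      have h1 : ((X ^ Nat.card K - X : E[X]).map (algebraMap E K)).Splits := by
        have := FiniteField.isSplittingField_sub K E
        rw [Nat.card_eq_fintype_card]
        exact this.splits
      refine h1.of_dvd ?_ (Polynomial.map_dvd _ hdv)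
      rw [Polynomial.map_ne_zero_iff (algebraMap E K).injective]
      exact FiniteField.X_pow_card_sub_X_ne_zero E Finite.one_lt_card
    have hsep : P.Separable := PerfectField.separable_of_irreducible hP.2.1
    rw [← card_rootSet_eq_natDegree hsep hsp, ← Set.toFinset_card]
    congr 1
    ext α
    rw [Finset.mem_filter, Set.mem_toFinset, mem_rootSet]
    constructor
    · rintro ⟨_, rfl⟩
      exact ⟨hP.1.ne_zero, minpoly.aeval _ _⟩
    · rintro ⟨_, h⟩
      exact ⟨Finset.mem_univ _, (minpoly.eq_of_irreducible_of_monic hP.2.1 h hP.1).symm⟩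
  · intro α hα
    rw [aux_norm_aeval, (Finset.mem_filter.1 hα).2, hr, map_pow]

end Res

open Polynomial

section Weil

theorem aux_exists_ext (E : Type*) [Field E] [Finite E] (r : ℕ) (hr : 1 ≤ r) :
    ∃ (K : Type) (_ : Field K) (_ : Fintype K) (_ : Algebra E K), Module.finrank E K = r := by
  obtain ⟨p, hp⟩ := CharP.exists E
  have : Fact p.Prime := ⟨CharP.char_is_prime E p⟩
  have : NeZero r := ⟨by omega⟩
  exact ⟨FiniteField.Extension E p r, inferInstance, Fintype.ofFinite _, inferInstance,
    FiniteField.finrank_extension E p r⟩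

/-- composition of a multiplicative character with the norm -/
noncomputable def normChar {E : Type*} (K : Type*) [Field E] [Field K] [Finite K] [Algebra E K]
    (χ : MulChar E ℂ) : MulChar K ℂ :=
  ⟨χ.toMonoidHom.comp (Algebra.norm E), fun a ha => by
    have h0 : a = 0 := by simpa [isUnit_iff_ne_zero] using ha
    subst h0
    have : Module.Finite E K := Module.Finite.of_finite
    have h1 : Algebra.norm E (0 : K) = 0 := Algebra.norm_zero
    change χ (Algebra.norm E (0 : K)) = 0
    rw [h1, MulChar.map_zero]⟩

theorem normChar_apply {E : Type*} (K : Type*) [Field E] [Field K] [Finite K] [Algebra E K]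
    (χ : MulChar E ℂ) (a : K) : normChar K χ a = χ (Algebra.norm E a) := rfl

theorem aux_ext_bound {E : Type*} [Field E] [Fintype E] {K : Type*} [Field K] [Fintype K]
    [Algebra E K] (i : ℕ) (hi : Module.finrank E K = 2 * i) (f : E[X]) (hf0 : f ≠ 0)
    (ℓ : ℕ) (hℓ : 1 < ℓ) (hdvd : ℓ ∣ Fintype.card E - 1) (χ : MulChar E ℂ) (hχ : χ ≠ 1)
    (hχℓ : χ ^ ℓ = 1)
    (H : ∀ (r : ℕ) (c : K) (S T : K[X]), c ≠ 0 → S ≠ 0 →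
      C c * (f.map (algebraMap E K)) ^ r * S ^ ℓ = T ^ ℓ → ℓ ∣ r)
    (hlarge : 100 * ℓ * (f.natDegree + 1) ≤ Fintype.card E ^ i) :
    ‖∑ α : K, χ (Algebra.norm E (aeval α f))‖ ≤
      (ℓ * (5 * f.natDegree + 9) + 1 + f.natDegree : ℕ) * (Fintype.card E : ℝ) ^ i := by
  obtain ⟨p, hp⟩ := CharP.exists E
  have : Fact p.Prime := ⟨CharP.char_is_prime E p⟩
  have : CharP K p := charP_of_injective_algebraMap (algebraMap E K).injective p
  obtain ⟨k, _, hk⟩ := FiniteField.card E p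
  have hcard : Fintype.card K = (Fintype.card E ^ i) ^ 2 := by
    rw [Module.card_eq_pow_finrank (K := E) (V := K), hi, mul_comm, pow_mul]
  have h1 : (1 : ℕ) ≤ Fintype.card E := Fintype.card_pos
  have hd2 : ℓ ∣ Fintype.card E ^ i - 1 := by
    refine hdvd.trans ?_
    have := Nat.sub_dvd_pow_sub_pow (Fintype.card E) 1 i
    rwa [one_pow] at this
  have hone : ∀ a : E, a ≠ 0 → (χ ^ ℓ) a = 1 := by
    intro a ha; rw [hχℓ]; exact MulChar.one_apply (isUnit_iff_ne_zero.2 ha)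
  have hnz : ∀ a : K, a ≠ 0 → Algebra.norm E a ≠ 0 := fun a ha => Algebra.norm_ne_zero_iff.2 ha
  have hψ : normChar K χ ≠ 1 := by
    intro h
    apply hχ
    ext a
    obtain ⟨b, hb⟩ := FiniteField.norm_surjective E K (a : E)
    have hb0 : b ≠ 0 := by
      rintro rfl
      rw [Algebra.norm_zero] at hb
      exact a.ne_zero hb.symm
    have h2 : normChar K χ b = 1 := by rw [h]; exact MulChar.one_apply (isUnit_iff_ne_zero.2 hb0)
    rw [normChar_apply, hb] at h2
    rw [h2, MulChar.one_apply_coe]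
  have hψℓ : normChar K χ ^ ℓ = 1 := by
    ext a
    rw [MulChar.pow_apply_coe, normChar_apply, MulChar.one_apply_coe]
    have := hone _ (hnz _ a.ne_zero)
    rwa [MulChar.pow_apply' _ (by omega)] at this
  have := aux_charsum p (k * i) (Fintype.card E ^ i) ℓ (by rw [hk, ← pow_mul]) hℓ hd2
    (f.map (algebraMap E K)) ((Polynomial.map_ne_zero_iff (algebraMap E K).injective).2 hf0)
    H hcard (normChar K χ) hψ hψℓ (by rwa [natDegree_map])
  rw [natDegree_map] at this
  simpa only [normChar_apply, eval_map_algebraMap, Nat.cast_pow] using this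

theorem aux_weil {E : Type*} [Field E] [Fintype E] (f G : E[X]) (hf : f.Monic) (hG : G.Monic)
    (N : ℕ) (hfG : f ∣ G ^ N) (hGf : G ∣ f) (hG1 : 1 ≤ G.natDegree)
    (ℓ : ℕ) (hℓ : 1 < ℓ) (hdvd : ℓ ∣ Fintype.card E - 1) (χ : MulChar E ℂ) (hχ : χ ≠ 1)
    (hχℓ : χ ^ ℓ = 1)
    (H : ∀ (K : Type) [Field K] [Algebra E K] (r : ℕ) (c : K) (S T : K[X]), c ≠ 0 → S ≠ 0 →
      C c * (f.map (algebraMap E K)) ^ r * S ^ ℓ = T ^ ℓ → ℓ ∣ r) :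
    ‖∑ α : E, χ (f.eval α)‖ ≤ (G.natDegree - 1 : ℕ) * Real.sqrt (Fintype.card E) := by
  classical
  set Q := Fintype.card E with hQ
  have hQ1 : 1 < Q := Fintype.one_lt_card
  set m := f.natDegree with hm
  set Cst : ℕ := ℓ * (5 * m + 9) + 1 + m with hC
  set Χ : E[X] → ℂ := fun h => χ (resultant f h) with hΧ
  have hΧmul : ∀ g h, Χ (g * h) = Χ g * Χ h := by
    intro g h; simp only [hΧ]; rw [aux_res_mul f hf, map_mul]
  have hΧ1 : Χ 1 = 1 := by
    simp only [hΧ]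
    rw [resultant_one_right, hf.coeff_natDegree]; simp
  have hΧmod : ∀ g h, G ∣ g - h → Χ g = Χ h := by
    intro g h hd; simp only [hΧ]; rw [aux_res_mod f hf G N hfG g h hd]
  set ε : ℂ := χ (-1) with hε
  have hε2 : ε ^ 2 = 1 := by
    rw [hε, ← map_pow]; simp
  have hεn : ‖ε‖ = 1 := Complex.norm_eq_one_of_pow_eq_one hε2 (by norm_num)
  have hΧcomm : ∀ P : E[X], Χ P = ε ^ (m * P.natDegree) * χ (resultant P f) := by
    intro P
    simp only [hΧ]
    rw [resultant_comm, map_mul, map_pow]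
  -- power sums
  set S : ℕ → ℂ := fun r => ∑ P ∈ irrDvd E r, (P.natDegree : ℂ) * Χ P ^ (r / P.natDegree) with hS
  have hSK : ∀ (K : Type) [Field K] [Fintype K] [Algebra E K] (r : ℕ), Module.finrank E K = r →
      S r = ε ^ (m * r) * ∑ α : K, χ (Algebra.norm E (aeval α f)) := by
    intro K _ _ _ r hr
    have hr1 : 1 ≤ r := by rw [← hr]; exact Module.finrank_pos
    rw [aux_Sr r hr, Finset.mul_sum]
    refine Finset.sum_congr rfl fun P hP => ?_
    rw [mem_irrDvd hr1] at hP
    rw [hΧcomm, mul_pow, ← pow_mul, mul_assoc m, Nat.mul_div_cancel' hP.2.2]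
    ring
  obtain ⟨i0, hi0⟩ : ∃ i0 : ℕ, ∀ i, i0 ≤ i → 100 * ℓ * (m + 1) ≤ Q ^ i := by
    refine ⟨100 * ℓ * (m + 1), fun i hi => ?_⟩
    exact hi.trans (Nat.lt_pow_self hQ1).le
  have hbound : ∀ (K : Type) [Field K] [Fintype K] [Algebra E K] (i : ℕ), i0 ≤ i →
      Module.finrank E K = 2 * i →
      ‖∑ α : K, χ (Algebra.norm E (aeval α f))‖ ≤ Cst * (Q : ℝ) ^ i := by
    intro K _ _ _ i hi hr
    exact aux_ext_bound i hr f hf.ne_zero ℓ hℓ hdvd χ hχ hχℓ (H K) (hi0 i hi)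
  -- nontriviality
  have hnontriv : ∃ h0 : E[X], IsCoprime G h0 ∧ Χ h0 ≠ 1 := by
    by_contra! hcon
    obtain ⟨i, hi, hi1, hi2⟩ : ∃ i, i0 ≤ i ∧ 1 ≤ i ∧ Cst + m < Q ^ i :=
      ⟨i0 + 1 + (Cst + m), by omega, by omega, lt_of_le_of_lt (by omega) (Nat.lt_pow_self hQ1)⟩
    obtain ⟨K, _, _, _, hK⟩ := aux_exists_ext E (2 * i) (by omega)
    have hb := hbound K i hi hK
    have hone : ∀ α : K, aeval α f ≠ 0 → χ (Algebra.norm E (aeval α f)) = 1 := by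
      intro α hα
      have hIntegral : IsIntegral E α := Algebra.IsIntegral.isIntegral α
      have hcop : IsCoprime f (minpoly E α) := by
        apply IsCoprime.symm
        rw [(minpoly.irreducible hIntegral).coprime_iff_not_dvd]
        intro hd
        exact hα ((minpoly.dvd_iff).1 hd)
      have h1 := hcon _ (hcop.of_isCoprime_of_dvd_left hGf)
      rw [hΧcomm] at h1
      rw [aux_norm_aeval, map_pow, hK]
      have hdeg : (minpoly E α).natDegree ∣ 2 * i := by rw [← hK]; exact minpoly.degree_dvd hIntegral
      have h2 := congrArg (· ^ (2 * i / (minpoly E α).natDegree)) h1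
      simp only [mul_pow, one_pow, ← pow_mul] at h2
      rw [mul_assoc m, Nat.mul_div_cancel' hdeg, show m * (2 * i) = 2 * (m * i) by ring, pow_mul,
        hε2, one_pow, one_mul] at h2
      exact h2
    have hsum : ∑ α : K, χ (Algebra.norm E (aeval α f)) =
        ((Finset.univ.filter (fun α : K => aeval α f ≠ 0)).card : ℂ) := by
      rw [Finset.card_filter]
      push_cast
      refine Finset.sum_congr rfl fun α _ => ?_
      split_ifs with h
      · exact hone α h
      · rw [not_not] at h
        rw [h, Algebra.norm_zero, MulChar.map_zero]
    have hge : Fintype.card K ≤ (Finset.univ.filter (fun α : K => aeval α f ≠ 0)).card + m := by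
      have h1 := Finset.card_filter_add_card_filter_not (s := (Finset.univ : Finset K))
        (fun α : K => aeval α f = 0)
      have h2 : (Finset.univ.filter (fun α : K => aeval α f = 0)).card ≤ m := by
        have h3 : (f.map (algebraMap E K)).roots.card ≤ m :=
          (card_roots' _).trans natDegree_map_le
        refine le_trans ?_ h3
        refine le_trans (Finset.card_le_card (t := (f.map (algebraMap E K)).roots.toFinset) ?_)
          (Multiset.toFinset_card_le _)
        intro α hα
        rw [Multiset.mem_toFinset, mem_roots ((hf.map _).ne_zero), IsRoot, eval_map_algebraMap]
        exact (Finset.mem_filter.1 hα).2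
      rw [Finset.card_univ] at h1
      have h4 : (Finset.univ.filter (fun α : K => aeval α f ≠ 0)).card =
        (Finset.univ.filter (fun α : K => ¬ aeval α f = 0)).card := rfl
      omega
    rw [hsum, Complex.norm_natCast] at hb
    have hb' : (Finset.univ.filter (fun α : K => aeval α f ≠ 0)).card ≤ Cst * Q ^ i := by
      exact_mod_cast hb
    have hcK : Fintype.card K = Q ^ i * Q ^ i := by
      rw [Module.card_eq_pow_finrank (K := E) (V := K), hK, two_mul, pow_add]
    have hQi : 1 ≤ Q ^ i := Nat.one_le_pow _ _ (by omega)
    have : (Cst + m + 1) * Q ^ i ≤ Q ^ i * Q ^ i := Nat.mul_le_mul_right _ hi2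
    nlinarith
  obtain ⟨h0, hcop, hne⟩ := hnontriv
  obtain ⟨ω, hω⟩ := aux_newton (G.natDegree - 1) (fun j => ∑ h ∈ monicDeg E j, Χ h) S
    (aux_monicDeg_zero Χ hΧ1)
    (fun j hj => aux_vanish Χ G hG h0 hcop hne (hΧmul h0) hΧmod j (by omega))
    (fun j => aux_rec Χ hΧ1 (fun g h _ _ => hΧmul g h) j)
  have hωle : ∀ j, ‖ω j ^ 2‖ ≤ (Q : ℝ) := by
    intro j
    refine aux_recurrence (fun j => ω j ^ 2) Cst Q (by positivity) (i0 + 1) ?_ j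
    intro i hi
    obtain ⟨K, _, _, _, hK⟩ := aux_exists_ext E (2 * i) (by omega)
    have h1 := hbound K i (by omega) hK
    have h2 := hSK K (2 * i) hK
    rw [hω (2 * i) (by omega)] at h2
    have h3 : ‖∑ j, (ω j ^ 2) ^ i‖ = ‖∑ α : K, χ (Algebra.norm E (aeval α f))‖ := by
      have h4 := congrArg norm h2
      rw [norm_neg, norm_mul, norm_pow, hεn, one_pow, one_mul] at h4
      rw [← h4]
      simp only [← pow_mul]
    rw [h3]
    exact h1
  have hS1 : ‖S 1‖ = ‖∑ α : E, χ (f.eval α)‖ := by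
    have h1 := aux_Sr (E := E) (K := E) 1 (Module.finrank_self E) f χ
    have h2 : S 1 = ε ^ (m * 1) * ∑ α : E, χ (Algebra.norm E (aeval α f)) := by
      rw [h1, Finset.mul_sum]
      refine Finset.sum_congr rfl fun P hP => ?_
      rw [mem_irrDvd le_rfl] at hP
      rw [hΧcomm, mul_pow, ← pow_mul, mul_assoc m, Nat.mul_div_cancel' hP.2.2]
      ring
    rw [h2, norm_mul, norm_pow, hεn, one_pow, one_mul]
    congr 1
    refine Finset.sum_congr rfl fun α _ => ?_
    rw [Algebra.norm_self, MonoidHom.id_apply, coe_aeval_eq_eval]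
  rw [← hS1, hω 1 le_rfl, norm_neg]
  refine (norm_sum_le _ _).trans ?_
  refine (Finset.sum_le_card_nsmul _ _ (Real.sqrt Q) ?_).trans ?_
  · intro j _
    rw [pow_one]
    apply Real.le_sqrt_of_sq_le
    rw [← norm_pow]
    exact hωle j
  · rw [Finset.card_univ, Fintype.card_fin, nsmul_eq_mul]

end Weil

open Polynomial

section Assembly

theorem aux_rootMult_pow {Om : Type*} [Field Om] (c : Om) (g : Om[X]) (hg : g ≠ 0) (n : ℕ) :
    rootMultiplicity c (g ^ n) = n * rootMultiplicity c g := by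
  induction n with
  | zero =>
    rw [pow_zero, zero_mul]
    apply rootMultiplicity_eq_zero
    simp
  | succ n ih =>
    rw [pow_succ, rootMultiplicity_mul (mul_ne_zero (pow_ne_zero _ hg) hg), ih]
    ring

theorem aux_coprime_irr {F ι : Type*} [Field F] (p : ι → F[X]) (hmon : ∀ i, (p i).Monic)
    (hirr : ∀ i, Irreducible (p i)) (hinj : Function.Injective p) (i j : ι) (hij : i ≠ j) :
    IsCoprime (p i) (p j) := by
  rw [(hirr i).coprime_iff_not_dvd]
  intro hd
  apply hij
  apply hinj
  exact eq_of_monic_of_associated (hmon i) (hmon j)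
    ((hirr i).associated_of_dvd (hirr j) hd)

theorem aux_H {F K ι : Type*} [Field F] [Finite F] [Field K] [Fintype ι] (φ : F →+* K)
    (p : ι → F[X]) (hmon : ∀ i, (p i).Monic) (hirr : ∀ i, Irreducible (p i))
    (hinj : Function.Injective p) (b : ι → ℕ) (ℓ : ℕ)
    (hb : ∀ t, (∀ i, ℓ ∣ t * b i) → ℓ ∣ t)
    (r : ℕ) (c : K) (S T : K[X]) (hc : c ≠ 0) (hS : S ≠ 0)
    (h : C c * ((∏ i, p i ^ b i).map φ) ^ r * S ^ ℓ = T ^ ℓ) : ℓ ∣ r := by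
  classical
  apply hb
  intro i
  set Om := AlgebraicClosure K
  set θ : K →+* Om := algebraMap K Om with hθ
  set φ' : F →+* Om := θ.comp φ with hφ'
  have hf0 : (∏ i, p i ^ b i) ≠ 0 :=
    (monic_prod_of_monic _ _ (fun i _ => (hmon i).pow _)).ne_zero
  have hp0 : (p i).map φ' ≠ 0 := (Polynomial.map_ne_zero_iff φ'.injective).2 (hmon i).ne_zero
  obtain ⟨x, hx⟩ : ∃ x, ((p i).map φ').IsRoot x := by
    apply IsAlgClosed.exists_root
    rw [degree_map]
    exact (degree_pos_of_irreducible (hirr i)).ne'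
  have hm1 : rootMultiplicity x ((p i).map φ') = 1 := by
    apply le_antisymm
    · apply rootMultiplicity_le_one_of_separable
      exact Separable.map (PerfectField.separable_of_irreducible (hirr i))
    · exact (rootMultiplicity_pos hp0).2 hx
  have hfm : rootMultiplicity x ((∏ i, p i ^ b i).map φ') = b i := by
    rw [← Finset.mul_prod_erase Finset.univ _ (Finset.mem_univ i), Polynomial.map_mul,
      Polynomial.map_pow]
    rw [rootMultiplicity_mul, aux_rootMult_pow _ _ hp0, hm1, rootMultiplicity_eq_zero]
    · ring
    · rw [IsRoot, Polynomial.map_prod, eval_prod, Finset.prod_eq_zero_iff]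
      rintro ⟨j, hj, hj0⟩
      rw [Polynomial.map_pow, eval_pow] at hj0
      have hj1 := eq_zero_of_pow_eq_zero hj0
      have hcop := (aux_coprime_irr p hmon hirr hinj i j (Finset.ne_of_mem_erase hj).symm).map
        (mapRingHom φ')
      obtain ⟨u, v, huv⟩ := hcop
      have := congrArg (eval x) huv
      rw [eval_add, eval_mul, eval_mul, coe_mapRingHom, hj1, hx.eq_zero] at this
      simp at this
    · rw [← Polynomial.map_pow, ← Polynomial.map_mul,
        Finset.mul_prod_erase Finset.univ (fun i => p i ^ b i) (Finset.mem_univ i)]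
      exact (Polynomial.map_ne_zero_iff φ'.injective).2 hf0
  have hS' : S.map θ ≠ 0 := (Polynomial.map_ne_zero_iff θ.injective).2 hS
  have hf' : (∏ i, p i ^ b i).map φ' ≠ 0 := (Polynomial.map_ne_zero_iff φ'.injective).2 hf0
  have h1 := congrArg (Polynomial.map θ) h
  simp only [Polynomial.map_mul, Polynomial.map_pow, map_C] at h1
  rw [Polynomial.map_map] at h1
  have hc' : C (θ c) ≠ 0 := by
    rw [Ne, C_eq_zero, map_eq_zero]; exact hc
  have hprod1 : C (θ c) * (map (θ.comp φ) (∏ i, p i ^ b i)) ^ r ≠ 0 :=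
    mul_ne_zero hc' (pow_ne_zero _ hf')
  have hprod2 := mul_ne_zero hprod1 (pow_ne_zero ℓ hS')
  by_cases hl0 : ℓ = 0
  · subst hl0
    have h2 := congrArg (rootMultiplicity x) h1
    rw [rootMultiplicity_mul hprod2, rootMultiplicity_mul hprod1, aux_rootMult_pow _ _ hf',
      hfm] at h2
    simp only [pow_zero] at h2
    have h3 : rootMultiplicity x (1 : Om[X]) = 0 := rootMultiplicity_eq_zero (by simp)
    rw [h3] at h2
    have : r * b i = 0 := by omega
    rw [this]
  have hT' : T.map θ ≠ 0 := by
    intro h0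
    rw [h0, zero_pow hl0] at h1
    exact hprod2 h1
  have h2 := congrArg (rootMultiplicity x) h1
  rw [rootMultiplicity_mul hprod2, rootMultiplicity_mul hprod1, aux_rootMult_pow _ _ hf',
    aux_rootMult_pow _ _ hS', aux_rootMult_pow _ _ hT', hfm] at h2
  have h3 : rootMultiplicity x (C (θ c)) = 0 :=
    rootMultiplicity_eq_zero (by simpa [IsRoot] using hc)
  rw [h3, zero_add] at h2
  have h4 : ℓ ∣ r * b i + ℓ * rootMultiplicity x (S.map θ) := by rw [h2]; exact dvd_mul_right _ _
  exact (Nat.dvd_add_left (dvd_mul_right _ _)).1 h4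

theorem aux_term {F E ι : Type*} [Field F] [Finite F] [Field E] [Fintype E] [Algebra F E]
    [Fintype ι] [Nonempty ι]
    (p : ι → F[X]) (hmon : ∀ i, (p i).Monic) (hirr : ∀ i, Irreducible (p i))
    (hinj : Function.Injective p) (ℓ : ℕ) (hℓ : 1 < ℓ) (hdvd : ℓ ∣ Fintype.card E - 1)
    (χ : MulChar E ℂ) (hχ : orderOf χ = ℓ) (a : ι → ℕ) (ha : ∃ i, ¬ ℓ ∣ a i) :
    ‖∑ α : E, ∏ i, χ (aeval α (p i)) ^ (a i + ℓ)‖ ≤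
      ((∏ i, p i).natDegree - 1 : ℕ) * Real.sqrt (Fintype.card E) := by
  classical
  set g := Nat.gcd ℓ (Finset.univ.gcd a) with hg
  have hg0 : 0 < g := Nat.gcd_pos_of_pos_left _ (by omega)
  obtain ⟨ℓ', hℓ'⟩ : g ∣ ℓ := Nat.gcd_dvd_left _ _
  have hga : ∀ i, g ∣ a i := fun i =>
    (Nat.gcd_dvd_right _ _).trans (Finset.gcd_dvd (Finset.mem_univ i))
  choose a' ha' using hga
  have hℓ'1 : 1 < ℓ' := by
    by_contra hcon
    have : ℓ' = 0 ∨ ℓ' = 1 := by omega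
    rcases this with h0 | h0
    · rw [h0] at hℓ'; omega
    · rw [h0, mul_one] at hℓ'
      obtain ⟨i, hi⟩ := ha
      apply hi
      rw [hℓ', ha' i]
      exact dvd_mul_right _ _
  have hb : ∀ t, (∀ i, ℓ' ∣ t * (a' i + ℓ')) → ℓ' ∣ t := by
    intro t ht
    have h1 : ∀ i, ℓ ∣ t * a i := by
      intro i
      have h2 : ℓ' ∣ t * a' i := by
        have := ht i
        rw [mul_add] at this
        exact (Nat.dvd_add_left (dvd_mul_left _ _)).1 this
      rw [hℓ', ha' i, show t * (g * a' i) = g * (t * a' i) by ring]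
      exact mul_dvd_mul_left _ h2
    have h3 : ℓ ∣ Finset.univ.gcd (fun i => t * a i) := Finset.dvd_gcd (fun i _ => h1 i)
    rw [Finset.gcd_mul_left, normalize_eq] at h3
    have h4 : ℓ ∣ Nat.gcd (t * ℓ) (t * Finset.univ.gcd a) := Nat.dvd_gcd (dvd_mul_left _ _) h3
    rw [Nat.gcd_mul_left, ← hg] at h4
    rw [hℓ', mul_comm t g] at h4
    exact Nat.dvd_of_mul_dvd_mul_left hg0 h4
  set f : F[X] := ∏ i, p i ^ (a' i + ℓ') with hf
  set G : F[X] := ∏ i, p i with hG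
  have hfm : f.Monic := monic_prod_of_monic _ _ (fun i _ => (hmon i).pow _)
  have hGm : G.Monic := monic_prod_of_monic _ _ (fun i _ => hmon i)
  have hGf : G ∣ f := Finset.prod_dvd_prod_of_dvd _ _ (fun i _ => dvd_pow_self _ (by omega))
  have hfG : f ∣ G ^ (∑ i, (a' i + ℓ')) := by
    rw [hG, ← Finset.prod_pow]
    exact Finset.prod_dvd_prod_of_dvd _ _ (fun i _ => pow_dvd_pow _
      (Finset.single_le_sum (f := fun i => a' i + ℓ') (fun _ _ => Nat.zero_le _)
        (Finset.mem_univ i)))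
  have hG1 : 1 ≤ G.natDegree := by
    obtain ⟨i⟩ := ‹Nonempty ι›
    have : p i ∣ G := Finset.dvd_prod_of_mem _ (Finset.mem_univ i)
    exact le_trans (hirr i).natDegree_pos (natDegree_le_of_dvd this hGm.ne_zero)
  have hχ1 : χ ^ g ≠ 1 := by
    intro h
    have := orderOf_dvd_of_pow_eq_one h
    rw [hχ] at this
    have := Nat.le_of_dvd hg0 this
    nlinarith
  have hχ2 : (χ ^ g) ^ ℓ' = 1 := by rw [← pow_mul, ← hℓ', ← hχ, pow_orderOf_eq_one]
  have hw := aux_weil (f.map (algebraMap F E)) (G.map (algebraMap F E)) (hfm.map _) (hGm.map _)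
    (∑ i, (a' i + ℓ')) (by rw [← Polynomial.map_pow]; exact Polynomial.map_dvd _ hfG)
    (Polynomial.map_dvd _ hGf) (by rwa [natDegree_map]) ℓ' hℓ'1
    ((Dvd.intro_left _ hℓ'.symm).trans hdvd) (χ ^ g) hχ1 hχ2 (by
      intro K _ _ r c S T hc hS h
      rw [Polynomial.map_map] at h
      exact aux_H ((algebraMap E K).comp (algebraMap F E)) p hmon hirr hinj _ ℓ' hb r c S T hc hS h)
  rw [natDegree_map] at hw
  convert hw using 3 with α
  rw [MulChar.pow_apply' _ hg0.ne', eval_map_algebraMap, hf, map_prod, map_prod, ← Finset.prod_pow]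
  refine Finset.prod_congr rfl fun i _ => ?_
  rw [map_pow, map_pow, ← pow_mul, ha' i]
  congr 1
  rw [hℓ']; ring

theorem aux_geom (x : ℂ) (ℓ : ℕ) (hℓ : 1 < ℓ) (hx : x = 0 ∨ x ^ ℓ = 1) :
    ∑ j : Fin ℓ, x ^ ((j : ℕ) + ℓ) = if x = 1 then (ℓ : ℂ) else 0 := by
  split_ifs with h
  · simp [h]
  · rcases hx with h0 | h1
    · refine Finset.sum_eq_zero fun j _ => ?_
      rw [h0, zero_pow (by omega)]
    · simp only [pow_add, h1, mul_one]
      rw [Fin.sum_univ_eq_sum_range (fun j => x ^ j)]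
      have := mul_geom_sum x ℓ
      rw [h1, sub_self] at this
      exact (mul_eq_zero.1 this).resolve_left (sub_ne_zero.2 h)

theorem aux_count {F E ι : Type*} [Field F] [Finite F] [Field E] [Fintype E] [Algebra F E]
    [Fintype ι] [Nonempty ι]
    (p : ι → F[X]) (hmon : ∀ i, (p i).Monic) (hirr : ∀ i, Irreducible (p i))
    (hinj : Function.Injective p) (ℓ : ℕ) (hℓ : 1 < ℓ) (hdvd : ℓ ∣ Fintype.card E - 1)
    (χ : MulChar E ℂ) (hχ : orderOf χ = ℓ) (A : Finset E)
    (hA : ∀ α, α ∈ A ↔ ∀ i, χ (aeval α (p i)) = 1) :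
    (Fintype.card E : ℝ) - (∏ i, p i).natDegree ≤ (ℓ : ℝ) ^ (Fintype.card ι) * A.card +
      ((ℓ : ℝ) ^ (Fintype.card ι) - 1) *
        (((∏ i, p i).natDegree - 1 : ℕ) * Real.sqrt (Fintype.card E)) := by
  classical
  set D := (∏ i, p i).natDegree with hD
  set G : F[X] := ∏ i, p i with hG
  have hGm : G.Monic := monic_prod_of_monic _ _ (fun i _ => hmon i)
  have hχℓ : χ ^ ℓ = 1 := by rw [← hχ, pow_orderOf_eq_one]
  have hval : ∀ x : E, x ≠ 0 → χ x ^ ℓ = 1 := by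
    intro x hx
    rw [← MulChar.pow_apply' _ (by omega), hχℓ]
    exact MulChar.one_apply (isUnit_iff_ne_zero.2 hx)
  have hval2 : ∀ x : E, χ x = 0 ∨ χ x ^ ℓ = 1 := by
    intro x
    by_cases hx : x = 0
    · left; rw [hx, MulChar.map_zero]
    · right; exact hval x hx
  set Tm : (ι → Fin ℓ) → ℂ := fun a => ∑ α : E, ∏ i, χ (aeval α (p i)) ^ ((a i : ℕ) + ℓ) with hTm
  have hsum : ∑ a, Tm a = (ℓ : ℂ) ^ (Fintype.card ι) * A.card := by
    simp only [hTm]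
    rw [Finset.sum_comm]
    have : ∀ α : E, ∑ a : ι → Fin ℓ, ∏ i, χ (aeval α (p i)) ^ ((a i : ℕ) + ℓ) =
        if α ∈ A then (ℓ : ℂ) ^ (Fintype.card ι) else 0 := by
      intro α
      rw [← Fintype.prod_sum (fun i (j : Fin ℓ) => χ (aeval α (p i)) ^ ((j : ℕ) + ℓ))]
      simp only [aux_geom _ ℓ hℓ (hval2 _)]
      split_ifs with h
      · rw [hA] at h
        simp [h]
      · rw [hA] at h
        push Not at h
        obtain ⟨i, hi⟩ := h
        exact Finset.prod_eq_zero (Finset.mem_univ i) (if_neg hi)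
    simp only [this]
    rw [← Finset.sum_filter, Finset.sum_const, nsmul_eq_mul, mul_comm]
    simp
  have : NeZero ℓ := ⟨by omega⟩
  set B : Finset E := Finset.univ.filter (fun α => aeval α G ≠ 0) with hB
  have hT0 : Tm 0 = B.card := by
    rw [hB, Finset.card_filter]
    push_cast
    simp only [hTm]
    refine Finset.sum_congr rfl fun α _ => ?_
    simp only [Pi.zero_apply, Fin.val_zero, zero_add]
    split_ifs with h
    · rw [hG, map_prod, Finset.prod_ne_zero_iff] at h
      exact Finset.prod_eq_one fun i hi => hval _ (h i hi)
    · rw [not_not, hG, map_prod, Finset.prod_eq_zero_iff] at h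
      obtain ⟨i, hi, h0⟩ := h
      refine Finset.prod_eq_zero hi ?_
      rw [h0, MulChar.map_zero, zero_pow (by omega)]
  have hBcard : (Fintype.card E : ℝ) - D ≤ B.card := by
    have h1 := Finset.card_filter_add_card_filter_not (s := (Finset.univ : Finset E))
      (fun α : E => aeval α G = 0)
    have h2 : (Finset.univ.filter (fun α : E => aeval α G = 0)).card ≤ D := by
      have h3 : (G.map (algebraMap F E)).roots.card ≤ D := (card_roots' _).trans natDegree_map_le
      refine le_trans ?_ h3
      refine le_trans (Finset.card_le_card (t := (G.map (algebraMap F E)).roots.toFinset) ?_)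
        (Multiset.toFinset_card_le _)
      intro α hα
      rw [Multiset.mem_toFinset, mem_roots ((hGm.map _).ne_zero), IsRoot, eval_map_algebraMap]
      exact (Finset.mem_filter.1 hα).2
    rw [Finset.card_univ] at h1
    have h3 : ((Finset.univ.filter (fun α : E => aeval α G = 0)).card : ℝ) +
        (B.card : ℝ) = Fintype.card E := by exact_mod_cast h1
    have h4 : ((Finset.univ.filter (fun α : E => aeval α G = 0)).card : ℝ) ≤ D := by
      exact_mod_cast h2
    linarith
  have hrest : ‖∑ a ∈ Finset.univ.erase (0 : ι → Fin ℓ), Tm a‖ ≤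
      ((ℓ : ℝ) ^ (Fintype.card ι) - 1) * ((D - 1 : ℕ) * Real.sqrt (Fintype.card E)) := by
    refine (norm_sum_le _ _).trans ?_
    refine (Finset.sum_le_card_nsmul _ _ ((D - 1 : ℕ) * Real.sqrt (Fintype.card E)) ?_).trans ?_
    · intro a ha
      refine aux_term p hmon hirr hinj ℓ hℓ hdvd χ hχ (fun i => (a i : ℕ)) ?_
      by_contra! hcon
      apply Finset.ne_of_mem_erase ha
      funext i
      apply Fin.ext
      have := Nat.eq_zero_of_dvd_of_lt (hcon i) (a i).isLt
      simpa using this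
    · rw [nsmul_eq_mul, Finset.card_erase_of_mem (Finset.mem_univ _), Finset.card_univ,
        Fintype.card_fun, Fintype.card_fin, Nat.cast_sub (Nat.one_le_pow _ _ (by omega))]
      push_cast
      exact le_rfl
  rw [← Finset.add_sum_erase _ _ (Finset.mem_univ (0 : ι → Fin ℓ)), hT0] at hsum
  have h5 : ∑ a ∈ Finset.univ.erase (0 : ι → Fin ℓ), Tm a =
      (((ℓ : ℝ) ^ (Fintype.card ι) * A.card - B.card : ℝ) : ℂ) := by
    push_cast
    rw [← hsum]; ring
  rw [h5, Complex.norm_real, Real.norm_eq_abs] at hrest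
  have := (abs_le.1 hrest).1
  linarith

end Assembly

section
open Polynomial

theorem aux_prod_deg {F : Type*} [Field F] [Fintype F] (d : ℕ) (hd : 1 ≤ d) :
    (∏ i : irrDvd F d, (i : F[X])).natDegree ≤ Fintype.card F ^ d := by
  have hmem := fun i : irrDvd F d => (mem_irrDvd hd).1 i.2
  have h1 : (∏ i : irrDvd F d, (i : F[X])) ∣ X ^ Fintype.card F ^ d - X := by
    refine Fintype.prod_dvd_of_coprime ?_ ?_
    · intro i j hij
      exact aux_coprime_irr (fun i : irrDvd F d => (i : F[X])) (fun i => (hmem i).1)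
        (fun i => (hmem i).2.1) Subtype.val_injective i j hij
    · intro i
      have := ((hmem i).2.1.natDegree_dvd_iff_dvd_X_pow_card_pow_sub_X (n := d)).1 (hmem i).2.2
      rwa [Nat.card_eq_fintype_card] at this
  have hc := Fintype.one_lt_card (α := F)
  have h2 := natDegree_le_of_dvd h1
    (FiniteField.X_pow_card_pow_sub_X_ne_zero F (by omega) hc)
  rwa [FiniteField.X_pow_card_pow_sub_X_natDegree_eq F (by omega) hc] at h2

theorem aux_card_le {F : Type*} [Field F] [Fintype F] (d : ℕ) (hd : 1 ≤ d) :
    (irrDvd F d).card ≤ (primarySet F d).ncard := by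
  rw [← Set.ncard_coe_finset]
  have hfin : (primarySet F d).Finite :=
    (aux_finite_monic F d).subset fun g hg => ⟨hg.1, hg.2.1⟩
  refine Set.ncard_le_ncard_of_injOn (fun p => p ^ (d / p.natDegree)) ?_ ?_ hfin
  · intro p hp
    obtain ⟨h1, h2, h3⟩ := (mem_irrDvd hd).1 hp
    refine ⟨h1.pow _, ?_, p, h1, h2, _, Nat.div_pos (Nat.le_of_dvd hd h3) h2.natDegree_pos, rfl⟩
    rw [natDegree_pow, Nat.div_mul_cancel h3]
  · intro p hp r hr hpr
    obtain ⟨h1, h2, h3⟩ := (mem_irrDvd hd).1 hp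
    obtain ⟨k1, k2, k3⟩ := (mem_irrDvd hd).1 hr
    have hpos := Nat.div_pos (Nat.le_of_dvd hd h3) h2.natDegree_pos
    simp only at hpr
    have : p ∣ r := by
      apply h2.prime.dvd_of_dvd_pow (n := d / r.natDegree)
      rw [← hpr]
      exact dvd_pow_self _ hpos.ne'
    exact eq_of_monic_of_associated h1 k1 (h2.associated_of_dvd k2 this)

open Classical in
theorem aux_bad {F E : Type*} [Field F] [Fintype F] [Field E] [Fintype E] [Algebra F E]
    (n : ℕ) (hn : 1 < n) (hE : Fintype.card E = Fintype.card F ^ n) :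
    (Finset.univ.filter fun α : E => (minpoly F α).natDegree ≠ n).card ≤
      Fintype.card F ^ (n / 2 + 1) := by
  have hc := Fintype.one_lt_card (α := F)
  have hfr : Module.finrank F E = n := by
    have := Module.card_eq_pow_finrank (K := F) (V := E)
    rw [hE] at this
    exact (Nat.pow_right_injective hc this).symm
  have hsub : (Finset.univ.filter fun α : E => (minpoly F α).natDegree ≠ n) ⊆
      (Finset.range (n / 2 + 1)).biUnion fun m =>
        if m = 0 then ∅ else (X ^ Fintype.card F ^ m - X : E[X]).roots.toFinset := by
    intro α hα
    simp only [Finset.mem_filter, Finset.mem_univ, true_and] at hα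
    have hIntegral : IsIntegral F α := Algebra.IsIntegral.isIntegral α
    have hdv := minpoly.degree_dvd hIntegral
    rw [hfr] at hdv
    have hpos := minpoly.natDegree_pos hIntegral
    have hle : (minpoly F α).natDegree ≤ n / 2 := by
      obtain ⟨c, hc'⟩ := hdv
      rcases c with _ | _ | c
      · omega
      · omega
      · rw [Nat.le_div_iff_mul_le (by norm_num)]; nlinarith
    rw [Finset.mem_biUnion]
    refine ⟨_, Finset.mem_range.2 (Nat.lt_succ_of_le hle), ?_⟩
    rw [if_neg hpos.ne', Multiset.mem_toFinset,
      mem_roots (FiniteField.X_pow_card_pow_sub_X_ne_zero E hpos.ne' hc)]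
    have h := ((minpoly.irreducible hIntegral).natDegree_dvd_iff_dvd_X_pow_card_pow_sub_X
      (n := (minpoly F α).natDegree)).1 dvd_rfl
    rw [Nat.card_eq_fintype_card] at h
    have h2 := (minpoly.dvd_iff).1 h
    simpa using h2
  refine (Finset.card_le_card hsub).trans (Finset.card_biUnion_le.trans ?_)
  have : ∀ m ∈ Finset.range (n / 2 + 1), (if m = 0 then ∅ else
      (X ^ Fintype.card F ^ m - X : E[X]).roots.toFinset : Finset E).card ≤ Fintype.card F ^ m := by
    intro m _
    split_ifs with h
    · simp
    · refine (Multiset.toFinset_card_le _).trans ((card_roots' _).trans ?_)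
      rw [FiniteField.X_pow_card_pow_sub_X_natDegree_eq E h hc]
  refine (Finset.sum_le_sum this).trans ?_
  exact (Nat.geomSum_lt hc (fun m hm => Finset.mem_range.1 hm)).le

theorem aux_size (q n d ℓ P k : ℕ) (hq : 1 < q) (hℓ : 1 < ℓ) (hk : k ≤ P)
    (hcond : 2 * (d : ℝ) + 2 * (P + 1) * (Real.log ℓ / Real.log q) ≤ (n : ℝ)) :
    2 * (q : ℝ) ^ d * (ℓ : ℝ) ^ k ≤ Real.sqrt ((q : ℝ) ^ n) := by
  have hq' : (1 : ℝ) < q := by exact_mod_cast hq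
  have hl' : (2 : ℝ) ≤ ℓ := by exact_mod_cast hℓ
  have hlq : 0 < Real.log q := Real.log_pos hq'
  have h1 : ((q : ℝ) ^ d * (ℓ : ℝ) ^ (P + 1)) ^ 2 ≤ (q : ℝ) ^ n := by
    rw [← Real.log_le_log_iff (by positivity) (by positivity)]
    rw [Real.log_pow, Real.log_mul (by positivity) (by positivity), Real.log_pow, Real.log_pow,
      Real.log_pow]
    have := mul_le_mul_of_nonneg_right hcond hlq.le
    have e : (2 * (d : ℝ) + 2 * (P + 1) * (Real.log ℓ / Real.log q)) * Real.log q =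
      2 * (d * Real.log q + (P + 1) * Real.log ℓ) := by field_simp
    rw [e] at this
    push_cast
    linarith
  have h2 := Real.le_sqrt_of_sq_le h1
  refine le_trans ?_ h2
  have h3 : (ℓ : ℝ) ^ k ≤ (ℓ : ℝ) ^ P := pow_le_pow_right₀ (by linarith) hk
  have h4 : 2 * (ℓ : ℝ) ^ k ≤ (ℓ : ℝ) ^ (P + 1) := by
    rw [pow_succ, mul_comm]
    exact mul_le_mul h3 hl' (by norm_num) (by positivity)
  have : (0 : ℝ) ≤ (q : ℝ) ^ d := by positivity
  nlinarith

theorem aux_index {F E : Type*} [Field F] [Field E] [Fintype E] [Algebra F E]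
    (χ : MulChar E ℂ) (S : Set Eˣ) (hS : ∀ u ∈ S, χ u = 1) :
    orderOf χ ∣ (Subgroup.closure S).index := by
  apply orderOf_dvd_of_pow_eq_one
  have hle : Subgroup.closure S ≤ χ.toUnitHom.ker := by
    rw [Subgroup.closure_le]
    intro u hu
    rw [SetLike.mem_coe, MonoidHom.mem_ker]
    ext
    rw [MulChar.coe_toUnitHom, hS u hu, Units.val_one]
  ext u
  rw [MulChar.pow_apply_coe, MulChar.one_apply_coe]
  have h := hle (Subgroup.pow_index_mem (Subgroup.closure S) u)
  rw [MonoidHom.mem_ker] at h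
  have := congrArg Units.val h
  rw [MulChar.coe_toUnitHom, Units.val_one, Units.val_pow_eq_pow_val, map_pow] at this
  exact this

/-- If `ℓ > 1` divides `q^n - 1` and `n ≥ 2d + 2(|P_d|+1) log_q ℓ`, then there is a degree-`n`
element `α` such that `ℓ` divides the index of the subgroup generated by `{g(α) : g ∈ P_d}`,
i.e. `ℓ` divides the number of connected components of `G_d(n,q,α)`. -/
theorem exists_alpha_index_divisible
    {F E : Type*} [Field F] [Fintype F] [Field E] [Fintype E] [Algebra F E]
    (q n d ℓ : ℕ) (hq : IsPrimePow q)
    (hcardF : Fintype.card F = q) (hcardE : Fintype.card E = q ^ n)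
    (hn : 1 < n) (hd : 1 ≤ d) (hdn : d < n)
    (hℓ : 1 < ℓ) (hdvd : ℓ ∣ q ^ n - 1)
    (hcond : 2 * (d : ℝ) + 2 * ((primarySet F d).ncard + 1) * (Real.log ℓ / Real.log q)
      ≤ (n : ℝ)) :
    ∃ α : E, (minpoly F α).natDegree = n ∧
      ℓ ∣ (Subgroup.closure
        {u : Eˣ | ∃ g ∈ primarySet F d, (u : E) = Polynomial.aeval α g}).index := by
  classical
  have hq1 : 1 < q := hq.one_lt
  have hmem := fun i : irrDvd F d => (mem_irrDvd hd).1 i.2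
  have hne : Nonempty (irrDvd F d) :=
    ⟨⟨X, (mem_irrDvd hd).2 ⟨monic_X, irreducible_X, by simp⟩⟩⟩
  obtain ⟨χ, hχ⟩ := MulChar.exists_mulChar_orderOf E (n := ℓ) (by rwa [hcardE])
    (Complex.isPrimitiveRoot_exp ℓ (by omega))
  set A : Finset E := Finset.univ.filter fun α =>
    ∀ i : irrDvd F d, χ (aeval α (i : F[X])) = 1 with hA
  suffices h : ∃ α ∈ A, (minpoly F α).natDegree = n by
    obtain ⟨α, hαA, hαn⟩ := h
    refine ⟨α, hαn, ?_⟩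
    rw [← hχ]
    apply aux_index (F := F)
    rintro u ⟨g, ⟨hg1, hg2, p, hp1, hp2, e, he, rfl⟩, hu⟩
    rw [hu, map_pow, map_pow]
    have hpI : p ∈ irrDvd F d := by
      refine (mem_irrDvd hd).2 ⟨hp1, hp2, ?_⟩
      rw [← hg2, natDegree_pow]
      exact dvd_mul_left _ _
    rw [(Finset.mem_filter.1 hαA).2 ⟨p, hpI⟩, one_pow]
  by_contra hcon
  push Not at hcon
  have hAB : A ⊆ Finset.univ.filter fun α : E => (minpoly F α).natDegree ≠ n := by
    intro α hα
    simpa using hcon α hα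
  have hAc := (Finset.card_le_card hAB).trans (aux_bad n hn (by rw [hcardE, hcardF]))
  rw [hcardF] at hAc
  have hcount := aux_count (fun i : irrDvd F d => (i : F[X])) (fun i => (hmem i).1)
    (fun i => (hmem i).2.1) Subtype.val_injective ℓ hℓ (by rwa [hcardE]) χ hχ A (by simp [hA])
  have hD := aux_prod_deg (F := F) d hd
  rw [hcardF] at hD
  have hsize := aux_size q n d ℓ _ _ hq1 hℓ (aux_card_le (F := F) d hd) hcond
  rw [hcardE, Fintype.card_coe] at hcount
  push_cast at hcount
  set D := (∏ i : irrDvd F d, (i : F[X])).natDegree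
  set w := Real.sqrt ((q : ℝ) ^ n) with hw
  set L := (ℓ : ℝ) ^ (irrDvd F d).card
  have hww : (q : ℝ) ^ n = w * w := (Real.mul_self_sqrt (by positivity)).symm
  have hL : 1 ≤ L := one_le_pow₀ (by exact_mod_cast hℓ.le)
  have hM : 1 ≤ (q : ℝ) ^ d := one_le_pow₀ (by exact_mod_cast hq1.le)
  have hqM : (q : ℝ) ≤ (q : ℝ) ^ d := by
    exact_mod_cast Nat.le_self_pow (by omega) q
  have hDM : (D : ℝ) ≤ (q : ℝ) ^ d := by exact_mod_cast hD
  have hDM1 : ((D - 1 : ℕ) : ℝ) ≤ (q : ℝ) ^ d - 1 := by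
    have : D - 1 + 1 ≤ q ^ d := by
      have := Nat.pow_pos (n := d) (show 0 < q by omega)
      omega
    have : ((D - 1 : ℕ) : ℝ) + 1 ≤ (q : ℝ) ^ d := by exact_mod_cast this
    linarith
  have hw0 : 0 ≤ w := Real.sqrt_nonneg _
  have hqw : (q : ℝ) ^ (n / 2) ≤ w := by
    apply Real.le_sqrt_of_sq_le
    rw [← pow_mul]
    exact pow_le_pow_right₀ (by exact_mod_cast hq1.le) (Nat.div_mul_le_self n 2)
  have hAw : (A.card : ℝ) ≤ (q : ℝ) ^ d * w := by
    have : (A.card : ℝ) ≤ (q : ℝ) ^ (n / 2 + 1) := by exact_mod_cast hAc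
    rw [pow_succ, mul_comm] at this
    exact this.trans (mul_le_mul hqM hqw (by positivity) (by positivity))
  rw [hww] at hcount
  set M := (q : ℝ) ^ d
  have e1 : L * A.card ≤ L * (M * w) := mul_le_mul_of_nonneg_left hAw (by linarith)
  have e2 : (L - 1) * (((D - 1 : ℕ) : ℝ) * w) ≤ (L - 1) * ((M - 1) * w) :=
    mul_le_mul_of_nonneg_left (mul_le_mul_of_nonneg_right hDM1 hw0) (by linarith)
  have e3 : 2 * M * L * w ≤ w * w := mul_le_mul_of_nonneg_right hsize hw0
  have e4 : 2 * M ≤ w := by nlinarith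
  have e5 : w * (L + M - 1) ≤ M := by nlinarith
  nlinarith

end
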